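/- arXiv:1508.07309 — 2 statements merged into one kernel-verified Lean document; each statement's English description precedes it below -/
import Mathlib

section
/- There is an absolute constant C > 0 such that for all real x ≥ 2, every nonzero integer a with |a| ≤ x^{1/2}, and every real R with 1 ≤ R ≤ x^{1/2}, one has | Σ_{q ≤ x} ρ_R*(x;q,a) − x · Σ_{r ≤ R} ( μ(r)²·μ(gcd(r,a))·φ(gcd(r,a))/(r·φ(r)) ) · ( log(x/r²) + 2γ − 1 ) | ≤ C·( R·x^{1/2} + |a|·(log x)² ), where q and r run over positive integers and γ is the Euler–Mascheroni constant. -/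
open Finset Real

/-- Vaughan's function `F_R(n) = ∑_{r ≤ R} μ(r)² μ((r,n)) φ((r,n)) / φ(r)`. -/
noncomputable def FR (R : ℝ) (n : ℤ) : ℝ :=
  ∑ r ∈ Finset.Icc 1 ⌊R⌋₊,
    (ArithmeticFunction.moebius r : ℝ) ^ 2 *
      (ArithmeticFunction.moebius (Int.gcd (r : ℤ) n) : ℝ) *
      (Nat.totient (Int.gcd (r : ℤ) n) : ℝ) / (Nat.totient r : ℝ)

/-- `ρ_R^*(x;q,a) = ∑_{n ≤ x, n ≡ a (q), n > a} F_R(n)`. -/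
noncomputable def rhoStar (R x : ℝ) (q : ℕ) (a : ℤ) : ℝ :=
  ∑ n ∈ (Finset.Icc 1 ⌊x⌋₊).filter (fun n : ℕ => a < (n : ℤ) ∧ (q : ℤ) ∣ (n : ℤ) - a),
    FR R n

/-- `ψ^*(x;q,a) = ∑_{n ≤ x, n ≡ a (q), n > a} Λ(n)`. -/
noncomputable def psiStar (x : ℝ) (q : ℕ) (a : ℤ) : ℝ :=
  ∑ n ∈ (Finset.Icc 1 ⌊x⌋₊).filter (fun n : ℕ => a < (n : ℤ) ∧ (q : ℤ) ∣ (n : ℤ) - a),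
    ArithmeticFunction.vonMangoldt n

/-- For squarefree `r`, this is `μ r` times the Ramanujan sum `c_r(n)`. -/
noncomputable def gcdWeight (r : ℕ) (n : ℤ) : ℝ :=
  (ArithmeticFunction.moebius (Int.gcd (r : ℤ) n) : ℝ) * (Nat.totient (Int.gcd (r : ℤ) n) : ℝ)

lemma totient_eq_prod_of_squarefree {n : ℕ} (hn : Squarefree n) :
    (Nat.totient n : ℝ) = ∏ p ∈ n.primeFactors, ((p : ℝ) - 1) := by
  have h := Nat.totient_mul_prod_primeFactors n
  rw [Nat.prod_primeFactors_of_squarefree hn, mul_comm] at h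
  rw [Nat.eq_of_mul_eq_mul_left (Nat.pos_of_ne_zero hn.ne_zero) h, Nat.cast_prod]
  refine prod_congr rfl fun p hp => ?_
  rw [Nat.cast_sub (Nat.prime_of_mem_primeFactors hp).one_le, Nat.cast_one]

lemma moebius_mul_totient_eq_sum {n : ℕ} (hn : Squarefree n) :
    (ArithmeticFunction.moebius n : ℝ) * (Nat.totient n : ℝ) =
      ∑ d ∈ n.divisors, (ArithmeticFunction.moebius d : ℝ) * d := by
  have h := ArithmeticFunction.IsMultiplicative.prodPrimeFactors_one_sub_of_squarefree (R := ℝ)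
    (ArithmeticFunction.id : ArithmeticFunction ℝ)
    ArithmeticFunction.isMultiplicative_id.natCast hn
  simp only [ArithmeticFunction.natCoe_apply, ArithmeticFunction.id_apply] at h
  have hm := ArithmeticFunction.isMultiplicative_moebius.prod_primeFactors hn
  rw [← h, ← hm, totient_eq_prod_of_squarefree hn, Int.cast_prod, ← prod_mul_distrib]
  refine prod_congr rfl fun p hp => ?_
  rw [ArithmeticFunction.moebius_apply_prime (Nat.prime_of_mem_primeFactors hp)]
  push_cast
  ring

lemma gcdWeight_eq_sum {r : ℕ} (hr : Squarefree r) (n : ℤ) :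
    gcdWeight r n = ∑ d ∈ r.divisors, if (d : ℤ) ∣ n then
      (ArithmeticFunction.moebius d : ℝ) * d else 0 := by
  have hdvd : Int.gcd (r : ℤ) n ∣ r := Int.natCast_dvd_natCast.1 (Int.gcd_dvd_left ..)
  rw [gcdWeight, moebius_mul_totient_eq_sum (hr.squarefree_of_dvd hdvd), ← sum_filter]
  refine sum_congr ?_ fun _ _ => rfl
  ext d
  simp only [Nat.mem_divisors, mem_filter]
  constructor
  · rintro ⟨h, -⟩
    exact ⟨⟨h.trans hdvd, hr.ne_zero⟩,
      (Int.natCast_dvd_natCast.2 h).trans (Int.gcd_dvd_right ..)⟩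
  · rintro ⟨⟨h, -⟩, h'⟩
    exact ⟨Int.natCast_dvd_natCast.1 (Int.dvd_coe_gcd (Int.natCast_dvd_natCast.2 h) h'),
      fun h0 => hr.ne_zero (Nat.eq_zero_of_zero_dvd (h0 ▸ hdvd))⟩

lemma gcdWeight_mul {h r : ℕ} (hc : Nat.Coprime h r) (n : ℤ) :
    gcdWeight (h * r) n = gcdWeight h n * gcdWeight r n := by
  have e (k : ℕ) : Int.gcd (k : ℤ) n = Nat.gcd k n.natAbs := by simp [Int.gcd]
  have hc' : Nat.Coprime (Nat.gcd h n.natAbs) (Nat.gcd r n.natAbs) :=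
    (hc.coprime_dvd_left (Nat.gcd_dvd_left ..)).coprime_dvd_right (Nat.gcd_dvd_left ..)
  have hmul : Nat.gcd (h * r) n.natAbs = Nat.gcd h n.natAbs * Nat.gcd r n.natAbs := by
    rw [Nat.gcd_comm, Nat.Coprime.gcd_mul _ hc, Nat.gcd_comm, Nat.gcd_comm _ r]
  simp only [gcdWeight, e, hmul,
    ArithmeticFunction.isMultiplicative_moebius.map_mul_of_coprime hc', Nat.totient_mul hc']
  push_cast
  ring

lemma gcdWeight_congr {r : ℕ} {m n : ℤ} (h : (r : ℤ) ∣ m - n) :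
    gcdWeight r m = gcdWeight r n := by
  obtain ⟨k, hk⟩ := h
  obtain rfl : m = n + r * k := by linarith
  simp [gcdWeight]

lemma abs_gcdWeight_le_totient {r : ℕ} (hr : r ≠ 0) (n : ℤ) :
    |gcdWeight r n| ≤ Nat.totient r := by
  have hdvd : Int.gcd (r : ℤ) n ∣ r := Int.natCast_dvd_natCast.1 (Int.gcd_dvd_left ..)
  have h1 : |(ArithmeticFunction.moebius (Int.gcd (r : ℤ) n) : ℝ)| ≤ 1 := by
    exact_mod_cast ArithmeticFunction.abs_moebius_le_one
  have h2 : (Nat.totient (Int.gcd (r : ℤ) n) : ℝ) ≤ Nat.totient r := by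
    exact_mod_cast Nat.le_of_dvd (Nat.totient_pos.2 (Nat.pos_of_ne_zero hr))
      (Nat.totient_dvd_of_dvd hdvd)
  rw [gcdWeight, abs_mul, Nat.abs_cast]
  calc _ ≤ 1 * (Nat.totient (Int.gcd (r : ℤ) n) : ℝ) := by gcongr
    _ ≤ _ := by rwa [one_mul]

lemma abs_card_dvd_linear_sub_le {d u : ℕ} (hd : 0 < d) (hc : Nat.Coprime d u) (a : ℤ) (V : ℕ) :
    |(#{v ∈ Ioc 0 V | (d : ℤ) ∣ u * (v : ℕ) + a} : ℝ) - V / d| ≤ 1 := by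
  obtain ⟨w, hw⟩ := Int.mod_coprime hc.symm
  obtain ⟨c, hcw⟩ : ∃ c : ℕ, (c : ℤ) ≡ -(w * a) [ZMOD d] := by
    have hd' : (d : ℤ) ≠ 0 := by exact_mod_cast hd.ne'
    refine ⟨(-(w * a) % d).toNat, ?_⟩
    rw [Int.toNat_of_nonneg (Int.emod_nonneg _ hd')]
    exact Int.mod_modEq _ _
  have hcong : {v ∈ Ioc 0 V | (d : ℤ) ∣ u * (v : ℕ) + a} = {v ∈ Ioc 0 V | v ≡ c [MOD d]} := by
    refine filter_congr fun v _ => ?_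
    rw [← Int.natCast_modEq_iff]
    have hwd : (d : ℤ) ∣ 1 - u * w := hw.dvd
    have hcd : (d : ℤ) ∣ -(w * a) - c := hcw.dvd
    constructor
    · intro h
      apply Int.modEq_of_dvd
      have : (c : ℤ) - v = w * -(u * v + a) - (-(w * a) - c) - (1 - u * w) * v := by ring
      rw [this]
      exact dvd_sub (dvd_sub (dvd_mul_of_dvd_right (dvd_neg.2 h) _) hcd)
        (dvd_mul_of_dvd_left hwd _)
    · intro h
      rw [show (u : ℤ) * v + a = (1 - u * w) * a - u * (-(w * a) - c) - u * (c - v) by ring]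
      exact dvd_sub (dvd_sub (dvd_mul_of_dvd_left hwd _) (dvd_mul_of_dvd_right hcd _))
        (dvd_mul_of_dvd_right h.dvd _)
  have hcard := Nat.Ioc_filter_modEq_card 0 V hd c
  have hle : ⌊((0 : ℕ) - c : ℚ) / d⌋ ≤ ⌊((V : ℕ) - c : ℚ) / d⌋ := by
    gcongr
    simp
  rw [max_eq_left (by linarith)] at hcard
  rw [hcong]
  have hq : |(#{v ∈ Ioc 0 V | v ≡ c [MOD d]} : ℚ) - V / d| ≤ 1 := by
    have : (#{v ∈ Ioc 0 V | v ≡ c [MOD d]} : ℚ) =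
      ⌊((V : ℕ) - c : ℚ) / d⌋ - ⌊((0 : ℕ) - c : ℚ) / d⌋ := by exact_mod_cast hcard
    rw [this]
    have e : (V : ℚ) / d = ((V : ℕ) - c : ℚ) / d - ((0 : ℕ) - c : ℚ) / d := by
      push_cast
      ring
    rw [e, abs_le]
    have h1 := Int.floor_le (((V : ℕ) - c : ℚ) / d)
    have h2 := Int.lt_floor_add_one (((V : ℕ) - c : ℚ) / d)
    have h3 := Int.floor_le (((0 : ℕ) - c : ℚ) / d)
    have h4 := Int.lt_floor_add_one (((0 : ℕ) - c : ℚ) / d)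
    constructor <;> linarith
  have hq' := (Rat.cast_le (K := ℝ)).2 hq
  push_cast at hq'
  exact hq'

lemma abs_sum_gcdWeight_of_coprime {r u : ℕ} (hr : Squarefree r) (hc : Nat.Coprime r u)
    (a : ℤ) (V : ℕ) :
    |∑ v ∈ Ioc 0 V, gcdWeight r (u * (v : ℕ) + a) - if r = 1 then (V : ℝ) else 0| ≤
      ∑ d ∈ r.divisors, (d : ℝ) := by
  have hmain : (if r = 1 then (V : ℝ) else 0) =
      ∑ d ∈ r.divisors, (ArithmeticFunction.moebius d : ℝ) * d * (V / d) := by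
    have h := congrArg (fun f : ArithmeticFunction ℤ => f r)
      ArithmeticFunction.coe_zeta_mul_moebius
    simp only [ArithmeticFunction.coe_zeta_mul_apply, ArithmeticFunction.one_apply] at h
    have h' : ∑ d ∈ r.divisors, (ArithmeticFunction.moebius d : ℝ) = if r = 1 then 1 else 0 := by
      exact_mod_cast h
    calc _ = (∑ d ∈ r.divisors, (ArithmeticFunction.moebius d : ℝ)) * V := by
          rw [h']; split_ifs <;> simp
      _ = _ := by
          rw [sum_mul]
          refine sum_congr rfl fun d hd => ?_
          have : (d : ℝ) ≠ 0 := by exact_mod_cast (Nat.pos_of_mem_divisors hd).ne'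
          field_simp
  have hsum : ∑ v ∈ Ioc 0 V, gcdWeight r (u * (v : ℕ) + a) =
      ∑ d ∈ r.divisors, (ArithmeticFunction.moebius d : ℝ) * d *
        (#{v ∈ Ioc 0 V | (d : ℤ) ∣ u * (v : ℕ) + a} : ℝ) := by
    simp_rw [gcdWeight_eq_sum hr]
    rw [sum_comm]
    refine sum_congr rfl fun d _ => ?_
    rw [← sum_filter, sum_const, nsmul_eq_mul, mul_comm]
  rw [hmain, hsum, ← sum_sub_distrib]
  refine (abs_sum_le_sum_abs _ _).trans (sum_le_sum fun d hd => ?_)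
  have h1 : |(ArithmeticFunction.moebius d : ℝ)| ≤ 1 := by
    exact_mod_cast ArithmeticFunction.abs_moebius_le_one
  have h2 := abs_card_dvd_linear_sub_le (Nat.pos_of_mem_divisors hd)
    (hc.coprime_dvd_left (Nat.dvd_of_mem_divisors hd)) a V
  rw [← mul_sub, abs_mul, abs_mul, Nat.abs_cast]
  calc _ ≤ 1 * (d : ℝ) * 1 := by gcongr
    _ = d := by ring

lemma mul_sum_divisors_le {h r : ℕ} (h0 : h ≠ 0) (r0 : r ≠ 0) :
    (h : ℝ) * ∑ d ∈ r.divisors, (d : ℝ) ≤ ∑ d ∈ (h * r).divisors, (d : ℝ) := by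
  have hinj : Set.InjOn (fun d => h * d) (r.divisors : Set ℕ) :=
    fun _ _ _ _ e => Nat.eq_of_mul_eq_mul_left (Nat.pos_of_ne_zero h0) e
  calc _ = ∑ e ∈ r.divisors.image (fun d => h * d), (e : ℝ) := by
        rw [sum_image hinj, mul_sum]
        push_cast
        rfl
    _ ≤ _ := by
        refine sum_le_sum_of_subset_of_nonneg (fun e he => ?_) fun _ _ _ => by positivity
        obtain ⟨d, hd, rfl⟩ := mem_image.1 he
        exact Nat.mem_divisors.2
          ⟨Nat.mul_dvd_mul_left _ (Nat.dvd_of_mem_divisors hd), mul_ne_zero h0 r0⟩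

/-- On an arithmetic progression with difference `u`, the weight `gcdWeight r` has mean value
`gcdWeight r a` or zero according to whether `r` divides `u`. -/
lemma abs_sum_gcdWeight_sub_le {r u : ℕ} (hr : Squarefree r) (a : ℤ) (V : ℕ) :
    |∑ v ∈ Ioc 0 V, gcdWeight r (u * (v : ℕ) + a) - if r ∣ u then gcdWeight r a * V else 0| ≤
      ∑ d ∈ r.divisors, (d : ℝ) := by
  obtain ⟨s, hs⟩ := Nat.gcd_dvd_left r u
  set h := Nat.gcd r u with hh
  have hs0 : s ≠ 0 := fun e => hr.ne_zero (by rw [hs, e, mul_zero])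
  have hh0 : h ≠ 0 := fun e => hr.ne_zero (by rw [hs, e, zero_mul])
  have hcop : Nat.Coprime h s := Nat.coprime_of_squarefree_mul (hs ▸ hr)
  have hsu : Nat.Coprime s u := by
    have h1 : Nat.gcd s u ∣ h :=
      Nat.dvd_gcd ((Nat.gcd_dvd_left s u).trans (hs ▸ Nat.dvd_mul_left s h))
        (Nat.gcd_dvd_right s u)
    exact Nat.eq_one_of_dvd_coprimes hcop h1 (Nat.gcd_dvd_left s u)
  have hsq : Squarefree s := hr.squarefree_of_dvd (hs ▸ Nat.dvd_mul_left s h)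
  have hfac (v : ℕ) : gcdWeight r (u * (v : ℕ) + a) =
      gcdWeight h a * gcdWeight s (u * (v : ℕ) + a) := by
    rw [hs, gcdWeight_mul hcop]
    congr 1
    apply gcdWeight_congr
    rw [add_sub_cancel_right]
    exact dvd_mul_of_dvd_left (Int.natCast_dvd_natCast.2 (Nat.gcd_dvd_right r u)) _
  have hiff : r ∣ u ↔ s = 1 := by
    rw [← Nat.gcd_eq_left_iff_dvd, ← hh]
    constructor
    · intro e
      exact Nat.eq_of_mul_eq_mul_left (Nat.pos_of_ne_zero hh0) (by rw [← hs, mul_one, e])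
    · rintro rfl
      rw [hs, mul_one]
  have hmain : (if r ∣ u then gcdWeight r a * V else 0) =
      gcdWeight h a * if s = 1 then (V : ℝ) else 0 := by
    by_cases h1 : s = 1
    · rw [if_pos (hiff.2 h1), if_pos h1, hs, h1, mul_one]
    · rw [if_neg (mt hiff.1 h1), if_neg h1, mul_zero]
  have hle : |gcdWeight h a| ≤ h :=
    (abs_gcdWeight_le_totient hh0 a).trans (by exact_mod_cast Nat.totient_le h)
  simp_rw [hfac]
  rw [hmain, ← mul_sum, ← mul_sub, abs_mul]
  calc _ ≤ (h : ℝ) * ∑ d ∈ s.divisors, (d : ℝ) := by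
        gcongr
        exact abs_sum_gcdWeight_of_coprime hsq hsu a V
    _ ≤ ∑ d ∈ (h * s).divisors, (d : ℝ) := mul_sum_divisors_le hh0 hs0
    _ = _ := by rw [← hs]

lemma sum_divisors_div_totient_eq {r : ℕ} (hr : Squarefree r) :
    (∑ d ∈ r.divisors, (d : ℝ)) / Nat.totient r =
      ∑ t ∈ r.primeFactors.powerset, ∏ p ∈ t, 2 / ((p : ℝ) - 1) := by
  have h := ArithmeticFunction.IsMultiplicative.prodPrimeFactors_one_add_of_squarefree (R := ℝ)
    (f := (ArithmeticFunction.id : ArithmeticFunction ℝ))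
    ArithmeticFunction.isMultiplicative_id.natCast hr
  simp only [ArithmeticFunction.natCoe_apply, ArithmeticFunction.id_apply] at h
  rw [← h, totient_eq_prod_of_squarefree hr, ← prod_div_distrib, ← prod_one_add]
  refine prod_congr rfl fun p hp => ?_
  have : (1 : ℝ) < p := by exact_mod_cast (Nat.prime_of_mem_primeFactors hp).one_lt
  have : (p : ℝ) - 1 ≠ 0 := by linarith
  field_simp
  ring

lemma sum_two_div_mul_pred_le (M : ℕ) :
    ∑ p ∈ Ioc 0 M with Nat.Prime p, 2 / ((p : ℝ) * (p - 1)) ≤ 2 := by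
  have hle : ∀ M : ℕ, ∑ n ∈ Ioc 1 (M + 1), 2 / ((n : ℝ) * (n - 1)) ≤ 2 - 2 / (M + 1) := by
    intro M
    induction M with
    | zero => simp
    | succ k ih =>
      rw [sum_Ioc_succ_top (by omega)]
      have : 2 / (((k + 1 + 1 : ℕ) : ℝ) * ((k + 1 + 1 : ℕ) - 1)) =
          2 / ((k : ℝ) + 1) - 2 / (((k + 1 : ℕ) : ℝ) + 1) := by
        push_cast
        have : (k : ℝ) + 1 ≠ 0 := by positivity
        have : (k : ℝ) + 1 + 1 ≠ 0 := by positivity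
        rw [show (k : ℝ) + 1 + 1 - 1 = k + 1 by ring]
        field_simp
        ring
      push_cast at *
      linarith
  refine (sum_le_sum_of_subset_of_nonneg (t := Ioc 1 (M + 1)) (fun p hp => ?_)
    fun n hn _ => ?_).trans ((hle M).trans ?_)
  · simp only [mem_filter, mem_Ioc] at hp ⊢
    exact ⟨hp.2.one_lt, by omega⟩
  · have : (1 : ℝ) < n := by exact_mod_cast (mem_Ioc.1 hn).1
    exact div_nonneg (by norm_num) (mul_nonneg (by linarith) (by linarith))
  · have : (0 : ℝ) ≤ 2 / (M + 1) := by positivity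
    linarith

/-- The function `σ/φ` is bounded on average over squarefree integers. -/
lemma sum_sum_divisors_div_totient_le (M : ℕ) :
    ∑ r ∈ Ioc 0 M with Squarefree r, (∑ d ∈ r.divisors, (d : ℝ)) / Nat.totient r ≤
      Real.exp 2 * M := by
  set P := {p ∈ Ioc 0 M | p.Prime} with hP
  have hw {t : Finset ℕ} (ht : t ⊆ P) : 0 ≤ ∏ p ∈ t, 2 / ((p : ℝ) - 1) := by
    refine prod_nonneg fun p hp => div_nonneg (by norm_num) ?_
    have : (1 : ℝ) < p := by exact_mod_cast (mem_filter.1 (ht hp)).2.one_lt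
    linarith
  calc _ ≤ ∑ r ∈ Ioc 0 M, ∑ t ∈ P.powerset,
          if (∏ p ∈ t, p) ∣ r then ∏ p ∈ t, 2 / ((p : ℝ) - 1) else 0 := by
        rw [sum_filter]
        refine sum_le_sum fun r hr => ?_
        rw [← sum_filter]
        split_ifs with hsq
        · rw [sum_divisors_div_totient_eq hsq]
          refine sum_le_sum_of_subset_of_nonneg (fun t ht => ?_)
            fun t ht _ => hw (mem_powerset.1 (mem_filter.1 ht).1)
          rw [mem_powerset] at ht
          rw [mem_filter, mem_powerset]
          refine ⟨fun p hp => ?_, ?_⟩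
          · have hpp := Nat.mem_primeFactors.1 (ht hp)
            have := Nat.le_of_dvd (mem_Ioc.1 hr).1 hpp.2.1
            exact mem_filter.2 ⟨mem_Ioc.2 ⟨hpp.1.pos, this.trans (mem_Ioc.1 hr).2⟩, hpp.1⟩
          · exact (prod_dvd_prod_of_subset _ _ _ ht).trans (Nat.prod_primeFactors_dvd r)
        · exact sum_nonneg fun t ht => hw (mem_powerset.1 (mem_filter.1 ht).1)
    _ = ∑ t ∈ P.powerset, (M / ∏ p ∈ t, p : ℕ) * ∏ p ∈ t, 2 / ((p : ℝ) - 1) := by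
        rw [sum_comm]
        refine sum_congr rfl fun t _ => ?_
        rw [← sum_filter, sum_const, nsmul_eq_mul, Nat.Ioc_filter_dvd_card_eq_div]
    _ ≤ ∑ t ∈ P.powerset, M * ∏ p ∈ t, 2 / ((p : ℝ) * (p - 1)) := by
        refine sum_le_sum fun t ht => ?_
        have e : ∏ p ∈ t, 2 / ((p : ℝ) * (p - 1)) =
            (∏ p ∈ t, 2 / ((p : ℝ) - 1)) / ((∏ p ∈ t, p : ℕ) : ℝ) := by
          rw [Nat.cast_prod, ← prod_div_distrib]
          refine prod_congr rfl fun p _ => ?_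
          rw [div_div, mul_comm]
        rw [e, mul_div_assoc', mul_comm (M : ℝ), mul_div_assoc, mul_comm]
        exact mul_le_mul_of_nonneg_left Nat.cast_div_le (hw (mem_powerset.1 ht))
    _ = M * ∏ p ∈ P, (1 + 2 / ((p : ℝ) * (p - 1))) := by rw [prod_one_add, mul_sum]
    _ ≤ M * Real.exp 2 := by
        gcongr
        refine le_trans (prod_le_prod (fun p hp => ?_) fun p _ => ?_)
          ((Real.exp_sum P fun p => 2 / ((p : ℝ) * (p - 1))).symm.le.trans
            (Real.exp_le_exp.2 (sum_two_div_mul_pred_le M)))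
        · have : (1 : ℝ) < p := by exact_mod_cast (mem_filter.1 hp).2.one_lt
          exact add_nonneg zero_le_one
            (div_nonneg (by norm_num) (mul_nonneg (by linarith) (by linarith)))
        · rw [add_comm]
          exact Real.add_one_le_exp _
    _ = _ := mul_comm _ _

/-- Dirichlet's hyperbola method. -/
lemma sum_divisors_eq_hyperbola (f : ℕ → ℝ) (N : ℕ) :
    ∑ m ∈ Ioc 0 N, #m.divisors * f m =
      ∑ u ∈ Ioc 0 N.sqrt, (2 * ∑ v ∈ Ioc 0 (N / u), f (u * v) -
        ∑ v ∈ Ioc 0 N.sqrt, f (u * v)) := by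
  set U := N.sqrt
  have hU1 : U * U ≤ N := Nat.sqrt_le N
  have hU2 : N < (U + 1) * (U + 1) := Nat.lt_succ_sqrt N
  have hUN : U ≤ N := Nat.sqrt_le_self N
  let g : ℕ → ℕ → ℝ := fun u v => if u * v ≤ N then f (u * v) else 0
  have hg (u v : ℕ) : g u v = g v u := by simp only [g, mul_comm]
  have hleft : ∑ m ∈ Ioc 0 N, #m.divisors * f m = ∑ u ∈ Ioc 0 N, ∑ v ∈ Ioc 0 N, g u v := by
    rw [← sum_product', ← sum_filter]
    have : ∀ m ∈ Ioc 0 N, (#m.divisors : ℝ) * f m =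
        ∑ z ∈ {z ∈ {z ∈ Ioc 0 N ×ˢ Ioc 0 N | z.1 * z.2 ≤ N} | z.1 * z.2 = m},
          f (z.1 * z.2) := by
      intro m hm
      rw [mem_Ioc] at hm
      have hset : {z ∈ {z ∈ Ioc 0 N ×ˢ Ioc 0 N | z.1 * z.2 ≤ N} | z.1 * z.2 = m} =
          m.divisorsAntidiagonal := by
        rw [Nat.divisorsAntidiagonal_eq_prod_filter_of_le hm.1.ne' hm.2, filter_filter]
        refine filter_congr fun z _ => ⟨fun h => h.2, fun h => ⟨h ▸ hm.2, h⟩⟩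
      rw [hset, sum_congr rfl fun z hz => by rw [(Nat.mem_divisorsAntidiagonal.1 hz).1], sum_const,
        nsmul_eq_mul, ← Nat.map_div_right_divisors, card_map]
    rw [sum_congr rfl this]
    refine sum_fiberwise_of_maps_to (fun z hz => ?_) _
    simp only [mem_filter, mem_product, mem_Ioc] at hz ⊢
    exact ⟨Nat.mul_pos hz.1.1.1 hz.1.2.1, hz.2⟩
  have hrow {u : ℕ} (hu : 0 < u) : ∑ v ∈ Ioc 0 (N / u), f (u * v) = ∑ v ∈ Ioc 0 N, g u v := by
    rw [← sum_filter]
    refine sum_congr ?_ fun _ _ => rfl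
    ext v
    simp only [mem_filter, mem_Ioc, Nat.le_div_iff_mul_le hu, mul_comm u]
    exact ⟨fun h => ⟨⟨h.1, (Nat.le_mul_of_pos_right v hu).trans h.2⟩, h.2⟩,
      fun h => ⟨h.1.1, h.2⟩⟩
  have hsq {u v : ℕ} (hu : u ∈ Ioc 0 U) (hv : v ∈ Ioc 0 U) : f (u * v) = g u v := by
    rw [mem_Ioc] at hu hv
    exact (if_pos ((Nat.mul_le_mul hu.2 hv.2).trans hU1)).symm
  have hbig {u v : ℕ} (hu : u ∈ Ioc U N) (hv : v ∈ Ioc U N) : g u v = 0 := by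
    rw [mem_Ioc] at hu hv
    exact if_neg (not_le.2 (hU2.trans_le (Nat.mul_le_mul hu.1 hv.1)))
  have hsplit (F : ℕ → ℝ) : ∑ u ∈ Ioc 0 N, F u = ∑ u ∈ Ioc 0 U, F u + ∑ u ∈ Ioc U N, F u :=
    (sum_Ioc_consecutive F (Nat.zero_le U) hUN).symm
  have hright : ∑ u ∈ Ioc 0 U, (2 * ∑ v ∈ Ioc 0 (N / u), f (u * v) - ∑ v ∈ Ioc 0 U, f (u * v)) =
      ∑ u ∈ Ioc 0 U, (2 * ∑ v ∈ Ioc 0 N, g u v - ∑ v ∈ Ioc 0 U, g u v) := by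
    refine sum_congr rfl fun u hu => ?_
    rw [hrow (mem_Ioc.1 hu).1, sum_congr rfl fun v hv => hsq hu hv]
  have hcross : ∑ u ∈ Ioc U N, ∑ v ∈ Ioc 0 U, g u v = ∑ u ∈ Ioc 0 U, ∑ v ∈ Ioc U N, g u v := by
    rw [sum_comm]
    simp_rw [hg]
  have hzero : ∑ u ∈ Ioc U N, ∑ v ∈ Ioc U N, g u v = 0 :=
    sum_eq_zero fun u hu => sum_eq_zero fun v hv => hbig hu hv
  rw [hleft, hright, hsplit]
  simp_rw [hsplit, sum_sub_distrib, ← mul_sum, sum_add_distrib]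
  rw [hcross, hzero]
  ring

lemma abs_mul_harmonic_floor_sub_le {t : ℝ} (ht : 0 < t) :
    |t * (harmonic ⌊t⌋₊ : ℝ) - t * (Real.log t + Real.eulerMascheroniConstant)| ≤ 2 := by
  rcases lt_or_ge t 1 with h1 | h1
  · rw [Nat.floor_eq_zero.2 h1, harmonic_zero]
    have h2 := Real.abs_log_mul_self_lt t ht h1.le
    have h3 := Real.one_half_lt_eulerMascheroniConstant
    have h4 := Real.eulerMascheroniConstant_lt_two_thirds
    rw [abs_lt] at h2
    push_cast
    rw [abs_le]
    constructor <;> nlinarith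
  · set K := ⌊t⌋₊
    have hK : 1 ≤ K := (Nat.one_le_floor_iff t).2 h1
    have hK1 : (1 : ℝ) ≤ K := by exact_mod_cast hK
    have hKt : (K : ℝ) ≤ t := Nat.floor_le ht.le
    have htK : t < K + 1 := Nat.lt_floor_add_one t
    have lo := Real.eulerMascheroniSeq_lt_eulerMascheroniConstant K
    have hi := Real.eulerMascheroniConstant_lt_eulerMascheroniSeq' K
    rw [Real.eulerMascheroniSeq] at lo
    rw [Real.eulerMascheroniSeq', if_neg (by omega)] at hi
    have l1 : Real.log K ≤ Real.log t := Real.log_le_log (by linarith) hKt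
    have l2 : Real.log t ≤ Real.log (K + 1) := Real.log_le_log ht htK.le
    have l3 : Real.log (K + 1) - Real.log K ≤ 1 / K := by
      rw [← Real.log_div (by linarith) (by linarith)]
      refine (Real.log_le_sub_one_of_pos (by positivity)).trans (le_of_eq ?_)
      field_simp
      ring
    have h : |(harmonic K : ℝ) - (Real.log t + Real.eulerMascheroniConstant)| ≤ 1 / K := by
      rw [abs_le]
      constructor <;> linarith
    rw [← mul_sub, abs_mul, abs_of_pos ht]
    calc _ ≤ t * (1 / K) := by gcongr
      _ ≤ 2 := by
        rw [mul_one_div, div_le_iff₀ (by linarith)]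
        linarith

lemma abs_sum_multiples_sub_le {N r : ℕ} (hN : 0 < N) (hr : 0 < r) :
    |∑ u ∈ Ioc 0 N.sqrt with r ∣ u, (2 * (N / u : ℝ) - N.sqrt) -
      N / r * (Real.log (N / (r : ℝ) ^ 2) + 2 * Real.eulerMascheroniConstant - 1)| ≤
        6 * √(N : ℝ) := by
  have hr0 : (0 : ℝ) < r := by exact_mod_cast hr
  have hs0 : 0 < √(N : ℝ) := Real.sqrt_pos.2 (by exact_mod_cast hN)
  have hss : √(N : ℝ) * √(N : ℝ) = N := Real.mul_self_sqrt (Nat.cast_nonneg N)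
  set s := √(N : ℝ)
  have ht0 : 0 < s / r := by positivity
  have hst : s / r ≤ s := div_le_self hs0.le (by exact_mod_cast hr)
  have hfl : N.sqrt / r = ⌊s / r⌋₊ := by
    rw [Nat.floor_div_natCast, Real.nat_floor_real_sqrt_eq_nat_sqrt]
  have hset : {u ∈ Ioc 0 N.sqrt | r ∣ u} = (Ioc 0 (N.sqrt / r)).image (fun k => r * k) := by
    ext u
    simp only [mem_filter, mem_Ioc, mem_image, Nat.le_div_iff_mul_le hr]
    constructor
    · rintro ⟨⟨h1, h2⟩, k, rfl⟩
      exact ⟨k, ⟨Nat.pos_of_mul_pos_left h1, by rwa [mul_comm]⟩, rfl⟩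
    · rintro ⟨k, ⟨h1, h2⟩, rfl⟩
      exact ⟨⟨Nat.mul_pos hr h1, by rwa [mul_comm]⟩, dvd_mul_right r k⟩
  have hsum : ∑ u ∈ Ioc 0 N.sqrt with r ∣ u, (2 * (N / u : ℝ) - N.sqrt) =
      2 * (N / r) * (harmonic ⌊s / r⌋₊ : ℝ) - N.sqrt * (⌊s / r⌋₊ : ℝ) := by
    rw [hset, sum_image (fun _ _ _ _ e => Nat.eq_of_mul_eq_mul_left hr e), sum_sub_distrib,
      sum_const, Nat.card_Ioc, hfl, harmonic_eq_sum_Icc, nsmul_eq_mul, Nat.sub_zero]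
    push_cast
    rw [mul_sum, mul_comm (N.sqrt : ℝ), ← Finset.Icc_succ_left_eq_Ioc]
    congr 1
    refine sum_congr rfl fun k _ => ?_
    rw [div_mul_eq_div_div, div_eq_mul_inv _ (k : ℝ), mul_assoc]
  have hlog : Real.log (N / (r : ℝ) ^ 2) = 2 * Real.log (s / r) := by
    rw [← hss, show s * s / (r : ℝ) ^ 2 = (s / r) ^ 2 by ring, Real.log_pow]
    norm_num
  have hU1 : (N.sqrt : ℝ) ≤ s := Real.nat_sqrt_le_real_sqrt
  have hU2 : s < N.sqrt + 1 := by
    rw [← Real.nat_floor_real_sqrt_eq_nat_sqrt]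
    exact Nat.lt_floor_add_one s
  have hF1 : (⌊s / r⌋₊ : ℝ) ≤ s / r := Nat.floor_le ht0.le
  have hF2 : s / r < ⌊s / r⌋₊ + 1 := Nat.lt_floor_add_one _
  have hH := abs_mul_harmonic_floor_sub_le ht0
  rw [hsum, hlog]
  have hF0 : (0 : ℝ) ≤ ⌊s / r⌋₊ := Nat.cast_nonneg _
  have hNr : (N : ℝ) / r = s * (s / r) := by rw [← hss]; ring
  rw [hNr]
  generalize (⌊s / r⌋₊ : ℝ) = F at *
  generalize (harmonic ⌊s / r⌋₊ : ℝ) = H at *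
  generalize s / r = t at *
  have e : 2 * (s * t) * H - N.sqrt * F -
      s * t * (2 * Real.log t + 2 * Real.eulerMascheroniConstant - 1) =
      2 * s * (t * H - t * (Real.log t + Real.eulerMascheroniConstant)) +
        (s * (t - F) + (s - N.sqrt) * F) := by ring
  rw [e]
  refine (abs_add_le _ _).trans ?_
  have h1 : |2 * s * (t * H - t * (Real.log t + Real.eulerMascheroniConstant))| ≤ 2 * s * 2 := by
    rw [abs_mul, abs_of_pos (by positivity)]
    gcongr
  have h2 : |s * (t - F) + (s - N.sqrt) * F| ≤ s * 1 + 1 * s := by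
    rw [abs_of_nonneg (add_nonneg (mul_nonneg hs0.le (by linarith))
      (mul_nonneg (by linarith) hF0))]
    gcongr <;> linarith
  linarith

/-- The divisor problem weighted by `gcdWeight r`, with an explicit dependence on `r`. -/
lemma abs_sum_divisors_mul_gcdWeight_sub_le {r : ℕ} (hr : Squarefree r) (a : ℤ) (N : ℕ) :
    |∑ m ∈ Ioc 0 N, #m.divisors * gcdWeight r ((m : ℕ) + a) - gcdWeight r a *
      (N / r * (Real.log (N / (r : ℝ) ^ 2) + 2 * Real.eulerMascheroniConstant - 1))| ≤
        √(N : ℝ) * (3 * ∑ d ∈ r.divisors, (d : ℝ) + 8 * Nat.totient r) := by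
  rcases Nat.eq_zero_or_pos N with rfl | hN
  · simp
  have hr0 : 0 < r := Nat.pos_of_ne_zero hr.ne_zero
  set S := ∑ d ∈ r.divisors, (d : ℝ)
  have hS0 : 0 ≤ S := sum_nonneg fun d _ => Nat.cast_nonneg d
  have hU1 : (N.sqrt : ℝ) ≤ √(N : ℝ) := Real.nat_sqrt_le_real_sqrt
  have hg := abs_gcdWeight_le_totient hr.ne_zero a
  have hφ : (0 : ℝ) ≤ Nat.totient r := Nat.cast_nonneg _
  let V : ℕ → ℝ := fun u => if r ∣ u then gcdWeight r a * (2 * (N / u : ℝ) - N.sqrt) else 0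
  have hrow : ∀ u ∈ Ioc 0 N.sqrt,
      |(2 * ∑ v ∈ Ioc 0 (N / u), gcdWeight r ((u * v : ℕ) + a) -
        ∑ v ∈ Ioc 0 N.sqrt, gcdWeight r ((u * v : ℕ) + a)) - V u| ≤
          3 * S + 2 * Nat.totient r := by
    intro u hu
    have hu0 : (0 : ℝ) < u := by exact_mod_cast (mem_Ioc.1 hu).1
    have h1 := abs_sum_gcdWeight_sub_le (u := u) hr a (N / u)
    have h2 := abs_sum_gcdWeight_sub_le (u := u) hr a N.sqrt
    have h3 : |V u - (2 * (if r ∣ u then gcdWeight r a * (N / u : ℕ) else 0) -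
        if r ∣ u then gcdWeight r a * N.sqrt else 0)| ≤ 2 * Nat.totient r := by
      simp only [V]
      split_ifs
      · have h4 : ((N / u : ℕ) : ℝ) ≤ N / u := Nat.cast_div_le
        have h5 : (N : ℝ) / u < (N / u : ℕ) + 1 := by
          rw [← Nat.floor_div_eq_div (K := ℝ)]
          exact Nat.lt_floor_add_one _
        have e : gcdWeight r a * (2 * (N / u : ℝ) - N.sqrt) -
            (2 * (gcdWeight r a * (N / u : ℕ)) - gcdWeight r a * N.sqrt) =
            gcdWeight r a * (2 * ((N / u : ℝ) - (N / u : ℕ))) := by ring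
        rw [e, abs_mul, abs_of_nonneg (by linarith : 0 ≤ 2 * ((N / u : ℝ) - (N / u : ℕ)))]
        calc _ ≤ (Nat.totient r : ℝ) * 2 := mul_le_mul hg (by linarith) (by linarith) hφ
          _ = _ := mul_comm _ _
      · simp
    push_cast
    rw [abs_le] at h1 h2 h3 ⊢
    constructor <;> linarith
  have hmain := abs_sum_multiples_sub_le hN hr0
  have hV : ∑ u ∈ Ioc 0 N.sqrt, V u = gcdWeight r a *
      ∑ u ∈ Ioc 0 N.sqrt with r ∣ u, (2 * (N / u : ℝ) - N.sqrt) := by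
    rw [mul_sum, sum_filter]
  rw [sum_divisors_eq_hyperbola (fun m => gcdWeight r ((m : ℕ) + a))]
  have hA : |∑ u ∈ Ioc 0 N.sqrt, (2 * ∑ v ∈ Ioc 0 (N / u), gcdWeight r ((u * v : ℕ) + a) -
        ∑ v ∈ Ioc 0 N.sqrt, gcdWeight r ((u * v : ℕ) + a)) - ∑ u ∈ Ioc 0 N.sqrt, V u| ≤
      √(N : ℝ) * (3 * S + 2 * Nat.totient r) := by
    rw [← sum_sub_distrib]
    refine (abs_sum_le_sum_abs _ _).trans ((sum_le_sum hrow).trans ?_)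
    rw [sum_const, Nat.card_Ioc, nsmul_eq_mul, Nat.sub_zero]
    gcongr
  have hB : |∑ u ∈ Ioc 0 N.sqrt, V u - gcdWeight r a *
      (N / r * (Real.log (N / (r : ℝ) ^ 2) + 2 * Real.eulerMascheroniConstant - 1))| ≤
      Nat.totient r * (6 * √(N : ℝ)) := by
    rw [hV, ← mul_sub, abs_mul]
    gcongr
  refine (abs_sub_le _ (∑ u ∈ Ioc 0 N.sqrt, V u) _).trans ((add_le_add hA hB).trans (le_of_eq ?_))
  ring

lemma FR_eq_sum_gcdWeight (R : ℝ) (n : ℤ) :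
    FR R n = ∑ r ∈ Ioc 0 ⌊R⌋₊ with Squarefree r, gcdWeight r n / Nat.totient r := by
  rw [FR, sum_filter, ← Finset.Icc_succ_left_eq_Ioc]
  refine sum_congr rfl fun r _ => ?_
  split_ifs with h
  · have : (ArithmeticFunction.moebius r : ℝ) ^ 2 = 1 := by
      exact_mod_cast ArithmeticFunction.moebius_sq_eq_one_of_squarefree h
    rw [this, one_mul, gcdWeight]
  · simp [ArithmeticFunction.moebius_eq_zero_of_not_squarefree h]

/-- The expected value of `∑_{m ≤ y} d(m) F_M(m + a)`. -/
noncomputable def divisorMainTerm (M : ℕ) (a : ℤ) (y : ℝ) : ℝ :=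
  ∑ r ∈ Ioc 0 M with Squarefree r, gcdWeight r a / Nat.totient r *
    (y / r * (Real.log (y / (r : ℝ) ^ 2) + 2 * Real.eulerMascheroniConstant - 1))

lemma mul_sum_eq_divisorMainTerm (M : ℕ) (a : ℤ) (y : ℝ) :
    y * ∑ r ∈ Finset.Icc 1 M,
      (ArithmeticFunction.moebius r : ℝ) ^ 2 *
        (ArithmeticFunction.moebius (Int.gcd (r : ℤ) a) : ℝ) *
        (Nat.totient (Int.gcd (r : ℤ) a) : ℝ) / ((r : ℝ) * (Nat.totient r : ℝ)) *
        (Real.log (y / (r : ℝ) ^ 2) + 2 * Real.eulerMascheroniConstant - 1) =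
      divisorMainTerm M a y := by
  rw [divisorMainTerm, sum_filter, ← Finset.Icc_succ_left_eq_Ioc, mul_sum]
  refine sum_congr rfl fun r _ => ?_
  split_ifs with h
  · have : (ArithmeticFunction.moebius r : ℝ) ^ 2 = 1 := by
      exact_mod_cast ArithmeticFunction.moebius_sq_eq_one_of_squarefree h
    rw [this, one_mul, gcdWeight]
    ring
  · simp [ArithmeticFunction.moebius_eq_zero_of_not_squarefree h]

lemma totient_pos_of_squarefree {r : ℕ} (hr : Squarefree r) : (0 : ℝ) < Nat.totient r := by
  exact_mod_cast Nat.totient_pos.2 (Nat.pos_of_ne_zero hr.ne_zero)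

lemma abs_sum_divisors_mul_FR_sub_le (R : ℝ) (a : ℤ) (N : ℕ) :
    |∑ m ∈ Ioc 0 N, #m.divisors * FR R ((m : ℕ) + a) - divisorMainTerm ⌊R⌋₊ a N| ≤
      √(N : ℝ) * ((3 * Real.exp 2 + 8) * ⌊R⌋₊) := by
  have hswap : ∑ m ∈ Ioc 0 N, #m.divisors * FR R ((m : ℕ) + a) =
      ∑ r ∈ Ioc 0 ⌊R⌋₊ with Squarefree r,
        (∑ m ∈ Ioc 0 N, #m.divisors * gcdWeight r ((m : ℕ) + a)) / Nat.totient r := by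
    simp_rw [FR_eq_sum_gcdWeight, mul_sum, sum_div]
    rw [sum_comm]
    refine sum_congr rfl fun r _ => sum_congr rfl fun m _ => ?_
    rw [mul_div_assoc]
  rw [hswap, divisorMainTerm, ← sum_sub_distrib]
  refine (abs_sum_le_sum_abs _ _).trans ?_
  calc _ ≤ ∑ r ∈ Ioc 0 ⌊R⌋₊ with Squarefree r,
        √(N : ℝ) * (3 * ((∑ d ∈ r.divisors, (d : ℝ)) / Nat.totient r) + 8) := by
        refine sum_le_sum fun r hr => ?_
        have hsq := (mem_filter.1 hr).2
        have hφ := totient_pos_of_squarefree hsq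
        have h := abs_sum_divisors_mul_gcdWeight_sub_le hsq a N
        rw [div_mul_eq_mul_div, ← sub_div, abs_div, abs_of_pos hφ, div_le_iff₀ hφ]
        refine h.trans (le_of_eq ?_)
        field_simp
    _ = √(N : ℝ) * (3 * (∑ r ∈ Ioc 0 ⌊R⌋₊ with Squarefree r,
          (∑ d ∈ r.divisors, (d : ℝ)) / Nat.totient r) +
            8 * #{r ∈ Ioc 0 ⌊R⌋₊ | Squarefree r}) := by
        rw [← mul_sum, sum_add_distrib, ← mul_sum, sum_const, nsmul_eq_mul]
        ring
    _ ≤ √(N : ℝ) * (3 * (Real.exp 2 * ⌊R⌋₊) + 8 * ⌊R⌋₊) := by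
        have hcard : (#{r ∈ Ioc 0 ⌊R⌋₊ | Squarefree r} : ℝ) ≤ ⌊R⌋₊ := by
          exact_mod_cast (card_filter_le _ _).trans (by simp)
        gcongr
        exact sum_sum_divisors_div_totient_le _
    _ = _ := by ring

lemma abs_sum_FR_le (R : ℝ) {k X : ℕ} (hk : k ≤ X) :
    |∑ n ∈ Ioc (X - k) X, FR R (n : ℕ)| ≤ k + 2 * (Real.exp 2 * ⌊R⌋₊) := by
  have hrow : ∀ r ∈ {r ∈ Ioc 0 ⌊R⌋₊ | Squarefree r},
      |(∑ n ∈ Ioc (X - k) X, gcdWeight r (n : ℕ)) / Nat.totient r| ≤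
        (if r = 1 then (k : ℝ) else 0) + 2 * ((∑ d ∈ r.divisors, (d : ℝ)) / Nat.totient r) := by
    intro r hr
    have hsq := (mem_filter.1 hr).2
    have hφ := totient_pos_of_squarefree hsq
    have h1 := abs_sum_gcdWeight_sub_le (u := 1) hsq 0 X
    have h2 := abs_sum_gcdWeight_sub_le (u := 1) hsq 0 (X - k)
    have h3 := sum_Ioc_consecutive (fun n : ℕ => gcdWeight r (n : ℕ)) (Nat.zero_le _)
      (Nat.sub_le X k)
    simp only [Nat.cast_one, one_mul, add_zero, Nat.dvd_one] at h1 h2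
    have h4 : |∑ n ∈ Ioc (X - k) X, gcdWeight r (n : ℕ)| ≤
        (if r = 1 then (k : ℝ) else 0) + 2 * ∑ d ∈ r.divisors, (d : ℝ) := by
      split_ifs at h1 h2 ⊢ with hr1
      · have hg : gcdWeight r 0 = 1 := by simp [hr1, gcdWeight]
        rw [hg, one_mul] at h1 h2
        rw [Nat.cast_sub hk] at h2
        rw [abs_le] at h1 h2 ⊢
        have : (0 : ℝ) ≤ k := Nat.cast_nonneg k
        constructor <;> linarith
      · rw [abs_le] at h1 h2 ⊢
        constructor <;> linarith
    rw [abs_div, abs_of_pos hφ, div_le_iff₀ hφ]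
    refine h4.trans (le_of_eq ?_)
    rw [add_mul, mul_assoc, div_mul_cancel₀ _ hφ.ne']
    split_ifs with hr1
    · simp [hr1]
    · simp
  simp_rw [FR_eq_sum_gcdWeight]
  rw [sum_comm]
  simp_rw [← sum_div]
  refine (abs_sum_le_sum_abs _ _).trans ((sum_le_sum hrow).trans ?_)
  rw [sum_add_distrib, ← mul_sum]
  gcongr
  · rw [sum_ite_eq']
    split_ifs
    · exact le_rfl
    · exact Nat.cast_nonneg k
  · exact sum_sum_divisors_div_totient_le _

lemma abs_mul_log_sub_le {y z : ℝ} (hy : 0 ≤ y) (hyz : y ≤ z) (hz : 1 ≤ z) :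
    |z * Real.log z - y * Real.log y| ≤ (z - y) * (Real.log z + 1) := by
  have hlz : 0 ≤ Real.log z := Real.log_nonneg hz
  rcases hy.eq_or_lt with rfl | hy
  · rw [zero_mul, sub_zero, sub_zero, abs_of_nonneg (by positivity)]
    nlinarith
  have hmono : Real.log y ≤ Real.log z := Real.log_le_log hy hyz
  have hup : y * (Real.log z - Real.log y) ≤ z - y := by
    rw [← Real.log_div (by linarith) hy.ne']
    have h := Real.log_le_sub_one_of_pos (show 0 < z / y by positivity)
    calc _ ≤ y * (z / y - 1) := by gcongr
      _ = z - y := by field_simp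
  have hlow : 0 ≤ y * (Real.log z - Real.log y) := mul_nonneg hy.le (by linarith)
  have hd : 0 ≤ (z - y) * Real.log z := mul_nonneg (by linarith) hlz
  rw [show z * Real.log z - y * Real.log y =
    (z - y) * Real.log z + y * (Real.log z - Real.log y) by ring, abs_of_nonneg (by linarith)]
  linarith

lemma abs_divisorMainTerm_sub_le (M : ℕ) (a : ℤ) {y z : ℝ} (hy : 0 ≤ y) (hyz : y ≤ z)
    (hz : 1 ≤ z) :
    |divisorMainTerm M a z - divisorMainTerm M a y| ≤
      (z - y) * (Real.log z + 2 * Real.log M + 2) * (1 + Real.log M) := by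
  have hlz : 0 ≤ Real.log z := Real.log_nonneg hz
  have hlM : 0 ≤ Real.log M := Real.log_natCast_nonneg M
  set B := (z - y) * (Real.log z + 2 * Real.log M + 2)
  have hB : 0 ≤ B := mul_nonneg (by linarith) (by linarith)
  have hγ1 := Real.one_half_lt_eulerMascheroniConstant
  have hγ2 := Real.eulerMascheroniConstant_lt_two_thirds
  rw [divisorMainTerm, divisorMainTerm, ← sum_sub_distrib]
  refine (abs_sum_le_sum_abs _ _).trans ?_
  calc _ ≤ ∑ r ∈ Ioc 0 M with Squarefree r, B * (r : ℝ)⁻¹ := by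
        refine sum_le_sum fun r hr => ?_
        obtain ⟨hrM, hsq⟩ := mem_filter.1 hr
        rw [mem_Ioc] at hrM
        have hφ := totient_pos_of_squarefree hsq
        have hr0 : (0 : ℝ) < r := by exact_mod_cast hrM.1
        have hlr : Real.log r ≤ Real.log M := Real.log_le_log hr0 (by exact_mod_cast hrM.2)
        have hlr0 : 0 ≤ Real.log r := Real.log_natCast_nonneg r
        have hexp {w : ℝ} (hw : 0 ≤ w) : w / r * (Real.log (w / (r : ℝ) ^ 2) +
            2 * Real.eulerMascheroniConstant - 1) = (w * Real.log w - 2 * w * Real.log r +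
              w * (2 * Real.eulerMascheroniConstant - 1)) * (r : ℝ)⁻¹ := by
          rcases hw.eq_or_lt with rfl | hw
          · simp
          rw [Real.log_div hw.ne' (by positivity), Real.log_pow]
          push_cast
          ring
        rw [← mul_sub, hexp hy, hexp (hy.trans hyz), abs_mul, ← sub_mul, abs_mul,
          abs_of_pos (inv_pos.2 hr0)]
        have h1 : |gcdWeight r a / Nat.totient r| ≤ 1 := by
          rw [abs_div, abs_of_pos hφ, div_le_one hφ]
          exact abs_gcdWeight_le_totient hsq.ne_zero a
        have h2 := abs_mul_log_sub_le hy hyz hz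
        have h3 : |z * Real.log z - 2 * z * Real.log r +
            z * (2 * Real.eulerMascheroniConstant - 1) - (y * Real.log y - 2 * y * Real.log r +
              y * (2 * Real.eulerMascheroniConstant - 1))| ≤ B := by
          have h4 : (z - y) * Real.log r ≤ (z - y) * Real.log M :=
            mul_le_mul_of_nonneg_left hlr (by linarith)
          have h5 : 0 ≤ (z - y) * Real.log r := mul_nonneg (by linarith) hlr0
          have h6 : 0 ≤ (z - y) * (2 * Real.eulerMascheroniConstant - 1) :=
            mul_nonneg (by linarith) (by linarith)
          have h7 : (z - y) * (2 * Real.eulerMascheroniConstant - 1) ≤ (z - y) * 1 :=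
            mul_le_mul_of_nonneg_left (by linarith) (by linarith)
          have hBe : B = (z - y) * (Real.log z + 1) + 2 * ((z - y) * Real.log M) + (z - y) * 1 := by
            simp only [B]
            ring
          rw [abs_le] at h2 ⊢
          constructor <;> linarith
        calc _ ≤ 1 * (B * (r : ℝ)⁻¹) := by gcongr
          _ = _ := one_mul _
    _ ≤ ∑ r ∈ Ioc 0 M, B * (r : ℝ)⁻¹ :=
        sum_le_sum_of_subset_of_nonneg (filter_subset _ _) fun r _ _ => by positivity
    _ = B * (harmonic M : ℝ) := by
        rw [← mul_sum, harmonic_eq_sum_Icc, ← Finset.Icc_succ_left_eq_Ioc]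
        push_cast
        rfl
    _ ≤ B * (1 + Real.log M) := by
        gcongr
        exact harmonic_le_one_add_log M

lemma card_divisors_le_eq {m X : ℕ} (hm : 0 < m) (hmX : m ≤ 2 * X) :
    (#{q ∈ Icc 1 X | q ∣ m} : ℝ) = #m.divisors - if X < m then 1 else 0 := by
  split_ifs with h
  · have : m.divisors = insert m {q ∈ Icc 1 X | q ∣ m} := by
      ext q
      simp only [Nat.mem_divisors, mem_insert, mem_filter, mem_Icc]
      constructor
      · rintro ⟨⟨k, rfl⟩, -⟩
        have hq := Nat.pos_of_mul_pos_right hm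
        have hk := Nat.pos_of_mul_pos_left hm
        rcases (show k = 1 ∨ 2 ≤ k by omega) with rfl | hk2
        · simp
        · exact Or.inr ⟨⟨hq, by nlinarith⟩, dvd_mul_right q k⟩
      · rintro (rfl | h')
        · exact ⟨dvd_rfl, hm.ne'⟩
        · exact ⟨h'.2, hm.ne'⟩
    rw [this, card_insert_of_notMem (by simp [h])]
    push_cast
    ring
  · have : m.divisors = {q ∈ Icc 1 X | q ∣ m} := by
      ext q
      simp only [Nat.mem_divisors, mem_filter, mem_Icc]
      exact ⟨fun h' => ⟨⟨Nat.pos_of_dvd_of_pos h'.1 hm,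
        (Nat.le_of_dvd hm h'.1).trans (not_lt.1 h)⟩, h'.1⟩, fun h' => ⟨h'.2, hm.ne'⟩⟩
    rw [this, sub_zero]

lemma sum_rhoStar_eq (R x : ℝ) (a : ℤ) :
    ∑ q ∈ Icc 1 ⌊x⌋₊, rhoStar R x q a =
      ∑ n ∈ Icc 1 ⌊x⌋₊ with a < (n : ℕ),
        (#{q ∈ Icc 1 ⌊x⌋₊ | ((q : ℕ) : ℤ) ∣ (n : ℕ) - a} : ℝ) * FR R (n : ℕ) := by
  simp_rw [rhoStar, ← filter_filter, sum_filter (fun n : ℕ => (_ : ℤ) ∣ (n : ℤ) - a)]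
  rw [sum_comm]
  refine sum_congr rfl fun n _ => ?_
  rw [← sum_filter, sum_const, nsmul_eq_mul]

lemma sum_rhoStar_of_pos (R x : ℝ) {k : ℕ} (hk : k ≤ ⌊x⌋₊) :
    ∑ q ∈ Icc 1 ⌊x⌋₊, rhoStar R x q (k : ℤ) =
      ∑ m ∈ Ioc 0 (⌊x⌋₊ - k), #m.divisors * FR R ((m : ℕ) + (k : ℤ)) := by
  rw [sum_rhoStar_eq]
  have hset : {n ∈ Icc 1 ⌊x⌋₊ | (k : ℤ) < (n : ℕ)} =
      (Ioc 0 (⌊x⌋₊ - k)).image (fun m => m + k) := by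
    ext n
    simp only [mem_filter, mem_Icc, mem_image, mem_Ioc]
    constructor
    · rintro ⟨h1, h2⟩
      exact ⟨n - k, by omega, by omega⟩
    · rintro ⟨m, h1, rfl⟩
      omega
  rw [hset, sum_image (fun _ _ _ _ e => Nat.add_right_cancel e)]
  refine sum_congr rfl fun m hm => ?_
  rw [mem_Ioc] at hm
  have h := card_divisors_le_eq (X := ⌊x⌋₊) hm.1 (by omega)
  rw [if_neg (by omega), sub_zero] at h
  rw [← h]
  push_cast
  simp_rw [add_sub_cancel_right, Int.natCast_dvd_natCast]

lemma sum_rhoStar_of_neg (R x : ℝ) {k : ℕ} (hk : k ≤ ⌊x⌋₊) :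
    ∑ q ∈ Icc 1 ⌊x⌋₊, rhoStar R x q (-(k : ℤ)) =
      ∑ m ∈ Ioc 0 (⌊x⌋₊ + k), #m.divisors * FR R ((m : ℕ) + -(k : ℤ)) -
        ∑ m ∈ Ioc 0 k, #m.divisors * FR R ((m : ℕ) + -(k : ℤ)) -
        ∑ n ∈ Ioc (⌊x⌋₊ - k) ⌊x⌋₊, FR R (n : ℕ) := by
  rw [sum_rhoStar_eq, ← sum_Ioc_consecutive _ (Nat.zero_le k) (Nat.le_add_left k ⌊x⌋₊),
    add_sub_cancel_left]
  have hall : {n ∈ Icc 1 ⌊x⌋₊ | -(k : ℤ) < (n : ℕ)} = Ioc 0 ⌊x⌋₊ := by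
    ext n
    simp only [mem_filter, mem_Icc, mem_Ioc]
    omega
  have hset : Ioc k (⌊x⌋₊ + k) = (Ioc 0 ⌊x⌋₊).image (fun n => n + k) := by
    rw [image_add_right_Ioc, zero_add]
  have htail : Ioc (⌊x⌋₊ - k) ⌊x⌋₊ = {n ∈ Ioc 0 ⌊x⌋₊ | ⌊x⌋₊ < n + k} := by
    ext n
    simp only [mem_filter, mem_Ioc]
    omega
  rw [hall, hset, sum_image (fun _ _ _ _ e => Nat.add_right_cancel e), htail, sum_filter,
    ← sum_sub_distrib]
  refine sum_congr rfl fun n hn => ?_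
  rw [mem_Ioc] at hn
  have h := card_divisors_le_eq (m := n + k) (X := ⌊x⌋₊) (by omega) (by omega)
  have e : ((n + k : ℕ) : ℤ) + -(k : ℤ) = (n : ℤ) := by push_cast; ring
  have e' : (n : ℤ) - -(k : ℤ) = ((n + k : ℕ) : ℤ) := by push_cast; ring
  simp_rw [e, e', Int.natCast_dvd_natCast]
  rw [h]
  split_ifs <;> ring

lemma abs_divisorMainTerm_sub_le_log_sq {x R y z : ℝ} (hx : 2 ≤ x) (hR : 1 ≤ R) (hRx : R ≤ √x)
    (a : ℤ) (hy : 0 ≤ y) (hyz : y ≤ z) (hz : 1 ≤ z) (hzx : z ≤ 2 * x) :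
    |divisorMainTerm ⌊R⌋₊ a z - divisorMainTerm ⌊R⌋₊ a y| ≤ 18 * ((z - y) * Real.log x ^ 2) := by
  have hL : 1 / 2 ≤ Real.log x := by
    have h1 := Real.log_two_gt_d9
    have h2 := Real.log_le_log (by norm_num) hx
    linarith
  have hlz : Real.log z ≤ 2 * Real.log x := by
    rw [← Real.log_rpow (by linarith)]
    refine Real.log_le_log (by linarith) ?_
    rw [Real.rpow_two]
    nlinarith
  have hM1 : (1 : ℝ) ≤ ⌊R⌋₊ := by exact_mod_cast (Nat.one_le_floor_iff R).2 hR
  have hlM : Real.log ⌊R⌋₊ ≤ Real.log x / 2 := by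
    rw [← Real.log_sqrt (by linarith)]
    exact Real.log_le_log (by linarith) ((Nat.floor_le (by linarith)).trans hRx)
  have hlM0 : 0 ≤ Real.log ⌊R⌋₊ := Real.log_nonneg hM1
  refine (abs_divisorMainTerm_sub_le _ a hy hyz hz).trans ?_
  have hlz0 : 0 ≤ Real.log z := Real.log_nonneg hz
  calc _ ≤ (z - y) * (7 * Real.log x) * (5 / 2 * Real.log x) := by
        have : 0 ≤ z - y := by linarith
        gcongr <;> linarith
    _ ≤ 18 * ((z - y) * Real.log x ^ 2) := by
        have : 0 ≤ (z - y) * Real.log x ^ 2 := mul_nonneg (by linarith) (sq_nonneg _)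
        nlinarith

/-- the average of `ρ_R*` over all moduli `q ≤ x`. -/
theorem rho_full_range :
    ∃ C : ℝ, 0 < C ∧ ∀ x : ℝ, 2 ≤ x → ∀ a : ℤ, a ≠ 0 → |(a : ℝ)| ≤ x ^ ((1 : ℝ) / 2) →
      ∀ R : ℝ, 1 ≤ R → R ≤ x ^ ((1 : ℝ) / 2) →
      |(∑ q ∈ Finset.Icc 1 ⌊x⌋₊, rhoStar R x q a)
          - x * ∑ r ∈ Finset.Icc 1 ⌊R⌋₊,
              (ArithmeticFunction.moebius r : ℝ) ^ 2 *
                (ArithmeticFunction.moebius (Int.gcd (r : ℤ) a) : ℝ) *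
                (Nat.totient (Int.gcd (r : ℤ) a) : ℝ) / ((r : ℝ) * (Nat.totient r : ℝ)) *
                (Real.log (x / (r : ℝ) ^ 2) + 2 * Real.eulerMascheroniConstant - 1)|
        ≤ C * (R * x ^ ((1 : ℝ) / 2) + |(a : ℝ)| * Real.log x ^ 2) := by
  refine ⟨3 * (3 * Real.exp 2 + 8) + 2 * Real.exp 2 + 40, by positivity, ?_⟩
  intro x hx a ha hax R hR hRx
  rw [← Real.sqrt_eq_rpow] at hax hRx ⊢
  rw [mul_sum_eq_divisorMainTerm]
  have hs1 : 1 ≤ √x := Real.one_le_sqrt.2 (by linarith)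
  have hsx : √x ≤ x := Real.sqrt_le_iff.2 ⟨by linarith, by nlinarith⟩
  have hL : 1 / 2 ≤ Real.log x := by
    have h1 := Real.log_two_gt_d9
    have h2 := Real.log_le_log (by norm_num) hx
    linarith
  have hX1 : (⌊x⌋₊ : ℝ) ≤ x := Nat.floor_le (by linarith)
  have hX2 : x < ⌊x⌋₊ + 1 := Nat.lt_floor_add_one x
  have hMR : (⌊R⌋₊ : ℝ) ≤ R := Nat.floor_le (by linarith)
  have hRs : R ≤ R * √x := le_mul_of_one_le_right (by linarith) hs1
  obtain ⟨k, hk⟩ := Int.eq_nat_or_neg a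
  have hak : |(a : ℝ)| = k := by rcases hk with rfl | rfl <;> simp
  rw [hak] at hax ⊢
  have hk1 : (1 : ℝ) ≤ k := by
    have : k ≠ 0 := by rintro rfl; simp_all
    exact_mod_cast Nat.one_le_iff_ne_zero.2 this
  have hkX : k ≤ ⌊x⌋₊ := Nat.le_floor (hax.trans hsx)
  have hkX' : (k : ℝ) ≤ ⌊x⌋₊ := by exact_mod_cast hkX
  set E := Real.exp 2
  have hE : 0 < E := Real.exp_pos 2
  have hkL : (k : ℝ) ≤ 4 * (k * Real.log x ^ 2) := by
    have hL2 : 1 ≤ 4 * Real.log x ^ 2 := by nlinarith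
    calc (k : ℝ) ≤ k * (4 * Real.log x ^ 2) := le_mul_of_one_le_right (by linarith) hL2
      _ = _ := by ring
  have hkL0 : 0 ≤ (k : ℝ) * Real.log x ^ 2 := by positivity
  have hRs0 : 0 ≤ R * √x := by positivity
  have hERs : 0 ≤ E * (R * √x) := by positivity
  have hEkL : 0 ≤ E * (k * Real.log x ^ 2) := by positivity
  have herr {N : ℕ} {c : ℝ} (h : √(N : ℝ) ≤ c * √x) :
      √(N : ℝ) * ((3 * E + 8) * ⌊R⌋₊) ≤ c * ((3 * E + 8) * (R * √x)) := by
    have h0 := (Real.sqrt_nonneg (N : ℝ)).trans h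
    calc _ ≤ c * √x * ((3 * E + 8) * R) := by gcongr
      _ = _ := by ring
  rcases hk with rfl | rfl
  · rw [sum_rhoStar_of_pos R x hkX]
    have hN : ((⌊x⌋₊ - k : ℕ) : ℝ) = ⌊x⌋₊ - k := Nat.cast_sub hkX
    have h1 := (abs_sum_divisors_mul_FR_sub_le R k (⌊x⌋₊ - k)).trans
      (herr (c := 1) (by rw [one_mul]; exact Real.sqrt_le_sqrt (by linarith)))
    have h2 := abs_divisorMainTerm_sub_le_log_sq hx hR hRx k
      (Nat.cast_nonneg (⌊x⌋₊ - k)) (by linarith) (by linarith : 1 ≤ x) (by linarith)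
    have h3 : (x - (⌊x⌋₊ - k : ℕ)) * Real.log x ^ 2 ≤ 2 * (k * Real.log x ^ 2) := by
      rw [← mul_assoc]
      gcongr
      linarith
    rw [abs_le] at h1 h2 ⊢
    constructor <;> linarith
  · rw [sum_rhoStar_of_neg R x hkX]
    have hN : ((⌊x⌋₊ + k : ℕ) : ℝ) = ⌊x⌋₊ + k := by push_cast; rfl
    have hsqrt : √((⌊x⌋₊ + k : ℕ) : ℝ) ≤ 2 * √x := by
      rw [Real.sqrt_le_left (by positivity), mul_pow, Real.sq_sqrt (by linarith)]
      linarith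
    have hsqrt' : √(k : ℝ) ≤ 1 * √x := by
      rw [one_mul]
      exact Real.sqrt_le_sqrt (by linarith)
    have h1 := (abs_sum_divisors_mul_FR_sub_le R (-k) (⌊x⌋₊ + k)).trans (herr hsqrt)
    have h2 := (abs_sum_divisors_mul_FR_sub_le R (-k) k).trans (herr hsqrt')
    have h3 := abs_divisorMainTerm_sub_le_log_sq hx hR hRx (-k) (by linarith : 0 ≤ x)
      (by linarith : x ≤ (⌊x⌋₊ + k : ℕ)) (by linarith) (by linarith)
    have h4 := abs_divisorMainTerm_sub_le_log_sq hx hR hRx (-k) le_rfl (Nat.cast_nonneg k)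
      hk1 (by linarith)
    have h0 : divisorMainTerm ⌊R⌋₊ (-k) 0 = 0 := by simp [divisorMainTerm]
    have h5 := abs_sum_FR_le R hkX
    have h6 : ((⌊x⌋₊ + k : ℕ) - x) * Real.log x ^ 2 ≤ k * Real.log x ^ 2 := by
      gcongr
      linarith
    have h7 : E * ⌊R⌋₊ ≤ E * (R * √x) := by
      gcongr
      linarith
    rw [h0, sub_zero, sub_zero] at h4
    rw [abs_le] at h1 h2 h3 h4 h5 ⊢
    constructor <;> linarith
end

section
/- There is an absolute constant C > 0 such that for all reals x ≥ 2, N, R with 1 ≤ N ≤ x and 1 ≤ R ≤ x, and every nonzero integer a with |a| < x/N and R ≥ |a|·N, one has | Σ_{x/N < q ≤ x, gcd(q,a)=1} ρ_R*(x;q,a) − x · Σ_{s ≤ N, gcd(s,a)=1} (1/φ(s))·(1 − s/N) | ≤ C·( 2^{ω(a)}·R·N + |a|·log 2N ), where q and s run over positive integers coprime to a, and ω(a) denotes the number of distinct prime factors of a. -/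
open Finset Real

/-- An interval of naturals meets each residue class modulo `m` in its expected share, up to `1`. -/
theorem abs_card_filter_modEq_sub_div_le (u v c : ℕ) {m : ℕ} (hm : 0 < m) :
    |(#{x ∈ Ioc u v | x ≡ c [MOD m]} : ℝ) - ((v - u : ℕ) : ℝ) / m| ≤ 1 := by
  rcases le_or_gt v u with h | h
  · simp [Ioc_eq_empty_of_le h, Nat.sub_eq_zero_of_le h]
  have hm' : (0 : ℚ) < m := by exact_mod_cast hm
  have hcard := Nat.Ioc_filter_modEq_card u v hm c
  have hfloor : ⌊((u : ℚ) - c) / m⌋ ≤ ⌊((v : ℚ) - c) / m⌋ := by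
    gcongr
  rw [max_eq_left (by linarith)] at hcard
  have hq : |(#{x ∈ Ioc u v | x ≡ c [MOD m]} : ℚ) - ((v - u : ℕ) : ℚ) / m| ≤ 1 := by
    rw [← Int.cast_natCast (R := ℚ) (#_), hcard, Nat.cast_sub h.le]
    have e : ((v : ℚ) - u) / m = (v - c) / m - (u - c) / m := by ring
    rw [e]
    push_cast
    rw [abs_le]
    constructor <;>
    linarith [Int.floor_le (((v : ℚ) - c) / m), Int.floor_le (((u : ℚ) - c) / m),
      Int.lt_floor_add_one (((v : ℚ) - c) / m), Int.lt_floor_add_one (((u : ℚ) - c) / m)]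
  have hr := (Rat.cast_le (K := ℝ)).2 hq
  simpa only [Rat.cast_abs, Rat.cast_sub, Rat.cast_div, Rat.cast_natCast, Rat.cast_one] using hr

theorem exists_forall_modEq_iff_modEq_prod (P : Finset ℕ) (hP : ∀ p ∈ P, p.Prime) (c : ℕ → ℕ) :
    ∃ k, ∀ q, (∀ p ∈ P, q ≡ c p [MOD p]) ↔ q ≡ k [MOD ∏ p ∈ P, p] := by
  induction P using Finset.induction_on with
  | empty => exact ⟨0, by simp [Nat.modEq_one]⟩
  | insert p P hp ih =>
    obtain ⟨k, hk⟩ := ih fun p' hp' => hP p' (mem_insert_of_mem hp')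
    have hco : Nat.Coprime p (∏ p ∈ P, p) := Nat.Coprime.prod_right fun p' hp' =>
      (Nat.coprime_primes (hP p (mem_insert_self ..)) (hP p' (mem_insert_of_mem hp'))).2
        fun h => hp (h ▸ hp')
    obtain ⟨l, hl⟩ := Nat.chineseRemainder hco (c p) k
    refine ⟨l, fun q => ?_⟩
    rw [forall_mem_insert, hk, prod_insert hp, ← Nat.modEq_and_modEq_iff_modEq_mul hco]
    exact and_congr ⟨fun h => h.trans hl.1.symm, fun h => h.trans hl.1⟩
      ⟨fun h => h.trans hl.2.symm, fun h => h.trans hl.2⟩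

/-- Summing a product of functions, each depending on whether `q` lies in one residue class modulo a
prime, over an interval gives the product of the means, with an explicit error. -/
theorem abs_sum_prod_residue_sub_le (P : Finset ℕ) (hP : ∀ p ∈ P, p.Prime) (c : ℕ → ℕ)
    (α β : ℕ → ℝ) (u v : ℕ) (L : ℝ) (hL : |((v - u : ℕ) : ℝ) - L| ≤ 1) :
    |∑ q ∈ Ioc u v, ∏ p ∈ P, (β p * (if q ≡ c p [MOD p] then 1 else 0) + α p)
        - L * ∏ p ∈ P, (β p / p + α p)| ≤ 2 * ∏ p ∈ P, (|β p| + |α p|) := by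
  simp_rw [prod_add, mul_sum]
  rw [sum_comm, ← sum_sub_distrib]
  refine (abs_sum_le_sum_abs _ _).trans (sum_le_sum fun D hD => ?_)
  rw [mem_powerset] at hD
  have hDp : ∀ p ∈ D, p.Prime := fun p hp => hP p (hD hp)
  obtain ⟨k, hk⟩ := exists_forall_modEq_iff_modEq_prod D hDp c
  have hpos : 0 < ∏ p ∈ D, p := prod_pos fun p hp => (hDp p hp).pos
  have hcount : ∑ q ∈ Ioc u v, (∏ p ∈ D, β p * (if q ≡ c p [MOD p] then 1 else 0)) *
        ∏ p ∈ P \ D, α p =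
      ((∏ p ∈ D, β p) * ∏ p ∈ P \ D, α p) *
        (#{q ∈ Ioc u v | q ≡ k [MOD ∏ p ∈ D, p]} : ℝ) := by
    rw [card_filter]
    push_cast
    rw [mul_sum]
    refine sum_congr rfl fun q _ => ?_
    rw [prod_mul_distrib, prod_ite_zero]
    simp only [prod_const_one, hk q]
    ring
  have hmain : |(#{q ∈ Ioc u v | q ≡ k [MOD ∏ p ∈ D, p]} : ℝ) - L / (∏ p ∈ D, p : ℕ)| ≤ 2 := by
    have h1 := abs_card_filter_modEq_sub_div_le u v k hpos
    have h2 : |((v - u : ℕ) : ℝ) / (∏ p ∈ D, p : ℕ) - L / (∏ p ∈ D, p : ℕ)| ≤ 1 := by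
      rw [← sub_div, abs_div, Nat.abs_cast]
      exact div_le_one_of_le₀ (hL.trans (by exact_mod_cast hpos)) (by positivity)
    calc _ ≤ _ := abs_sub_le _ (((v - u : ℕ) : ℝ) / (∏ p ∈ D, p : ℕ)) _
      _ ≤ 2 := by linarith
  rw [hcount, prod_div_distrib, show L * ((∏ p ∈ D, β p) / (∏ p ∈ D, (p : ℝ)) * ∏ p ∈ P \ D, α p) =
    ((∏ p ∈ D, β p) * ∏ p ∈ P \ D, α p) * (L / (∏ p ∈ D, p : ℕ)) by push_cast; ring, ← mul_sub,
    abs_mul, abs_mul, abs_prod, abs_prod, mul_comm]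
  gcongr

theorem sum_filter_primeFactors_subset_le (A S : Finset ℕ) (hA : ∀ r ∈ A, Squarefree r)
    (f : ℕ → ℝ) (hf : ∀ p ∈ S, 0 ≤ f p) (hAS : ∀ r ∈ A, r.primeFactors ⊆ S) :
    ∑ r ∈ A, ∏ p ∈ r.primeFactors, f p ≤ ∏ p ∈ S, (1 + f p) := by
  have hinj : Set.InjOn Nat.primeFactors (A : Set ℕ) := fun r hr r' hr' h => by
    rw [← Nat.prod_primeFactors_of_squarefree (hA r hr), h,
      Nat.prod_primeFactors_of_squarefree (hA r' hr')]
  rw [prod_one_add, ← sum_image (f := fun P => ∏ p ∈ P, f p) hinj]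
  refine sum_le_sum_of_subset_of_nonneg (image_subset_iff.2 fun r hr => mem_powerset.2 (hAS r hr))
    fun P hP _ => prod_nonneg fun p hp => hf p (mem_powerset.1 hP hp)

theorem abs_sum_squarefree_prod_le (M : ℕ) (S : Finset ℕ) (w : ℕ → ℝ)
    (hw : ∀ p, p.Prime → p ∉ S → w p = 0) :
    |∑ r ∈ Icc 1 M with Squarefree r, ∏ p ∈ r.primeFactors, w p| ≤ ∏ p ∈ S, (1 + |w p|) := by
  refine (abs_sum_le_sum_abs _ _).trans ?_
  simp_rw [abs_prod]
  rw [← sum_filter_of_ne (p := fun r => r.primeFactors ⊆ S)]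
  · exact sum_filter_primeFactors_subset_le _ _ (by simp +contextual) _ (fun _ _ => abs_nonneg _)
      (by simp +contextual)
  · intro r _ hr p hp
    by_contra hpS
    exact hr (prod_eq_zero hp (by rw [hw p (Nat.prime_of_mem_primeFactors hp) hpS, abs_zero]))

theorem sum_squarefree_prod_eq {M K : ℕ} (hK : K ≠ 0) (hKM : K ≤ M) (w : ℕ → ℝ)
    (hw : ∀ p, p.Prime → p ∉ K.primeFactors → w p = 0) :
    ∑ r ∈ Icc 1 M with Squarefree r, ∏ p ∈ r.primeFactors, w p =
      ∏ p ∈ K.primeFactors, (1 + w p) := by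
  rw [prod_one_add]
  have hprod : ∀ D ∈ K.primeFactors.powerset, (∏ p ∈ D, p).primeFactors = D := fun D hD =>
    Nat.primeFactors_prod fun p hp => Nat.prime_of_mem_primeFactors (mem_powerset.1 hD hp)
  symm
  refine sum_of_injOn (fun D => ∏ p ∈ D, p) ?_ ?_ ?_ ?_
  · intro D hD D' hD' h
    dsimp only at h
    rw [← hprod D hD, ← hprod D' hD', h]
  · intro D hD
    have hD' := mem_powerset.1 hD
    have hdvd : ∏ p ∈ D, p ∣ K :=
      (prod_dvd_prod_of_subset _ _ _ hD').trans (Nat.prod_primeFactors_dvd K)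
    have hpr : ∀ p ∈ D, p.Prime := fun p hp => Nat.prime_of_mem_primeFactors (hD' hp)
    simp only [coe_filter, mem_Icc, Set.mem_ofPred_eq]
    refine ⟨⟨prod_pos fun p hp => (hpr p hp).pos,
      (Nat.le_of_dvd (Nat.pos_of_ne_zero hK) hdvd).trans hKM⟩, ?_⟩
    exact Finset.squarefree_prod_of_pairwise_isCoprime
      (fun p hp p' hp' h => Nat.coprime_iff_isRelPrime.1
        ((Nat.coprime_primes (hpr p hp) (hpr p' hp')).2 h))
      fun p hp => (hpr p hp).squarefree
  · intro r hr hr'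
    by_contra hne
    refine hr' ⟨r.primeFactors, ?_, ?_⟩
    · rw [mem_coe, mem_powerset]
      intro p hp
      by_contra hpK
      exact hne (prod_eq_zero hp (hw p (Nat.prime_of_mem_primeFactors hp) hpK))
    · exact Nat.prod_primeFactors_of_squarefree (mem_filter.1 hr).2
  · intro D hD
    rw [hprod D hD]

theorem prod_primes_one_add_le_exp_two (M : ℕ) :
    ∏ p ∈ Icc 1 M with p.Prime, (1 + 2 / ((p : ℝ) - 1) / p) ≤ exp 2 := by
  have hind : ∀ M : ℕ, 1 ≤ M → ∑ n ∈ Ioc 1 M, 2 / ((n : ℝ) - 1) / n = 2 - 2 / M := by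
    intro M hM
    induction M, hM using Nat.le_induction with
    | base => simp
    | succ k hk ih =>
      have : (0 : ℝ) < k := by exact_mod_cast hk
      rw [sum_Ioc_succ_top hk, ih]
      push_cast
      rw [add_sub_cancel_right]
      field_simp
      ring
  have hsum : ∑ p ∈ Icc 1 M with p.Prime, 2 / ((p : ℝ) - 1) / p ≤ 2 := by
    rcases Nat.eq_zero_or_pos M with rfl | hM
    · simp
    calc _ ≤ ∑ n ∈ Ioc 1 M, 2 / ((n : ℝ) - 1) / n := by
          refine sum_le_sum_of_subset_of_nonneg ?_ ?_
          · intro p hp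
            simp only [mem_filter, mem_Icc, mem_Ioc] at hp ⊢
            exact ⟨hp.2.one_lt, hp.1.2⟩
          · intro n hn _
            have : (1 : ℝ) < n := by exact_mod_cast (mem_Ioc.1 hn).1
            have : (0 : ℝ) < (n : ℝ) - 1 := by linarith
            positivity
      _ ≤ 2 := by
        rw [hind M hM]
        have : (0 : ℝ) ≤ 2 / M := by positivity
        linarith
  refine le_trans ?_ (exp_le_exp.2 hsum)
  rw [exp_sum]
  refine prod_le_prod (fun p hp => ?_) fun p _ => by linarith [add_one_le_exp (2 / ((p : ℝ) - 1) / p)]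
  have : (1 : ℝ) < p := by exact_mod_cast (mem_filter.1 hp).2.one_lt
  have : (0 : ℝ) < (p : ℝ) - 1 := by linarith
  positivity

theorem sum_mul_prod_primeFactors_le (M : ℕ) (w : ℕ → ℝ) (W : ℝ)
    (hw : ∀ d : ℕ, 0 < d → ∑ s ∈ Icc 1 M with d ∣ s, w s ≤ W / d) (hw0 : ∀ s, 0 ≤ w s) :
    ∑ s ∈ Icc 1 M, w s * ∏ p ∈ s.primeFactors, (1 + 2 / ((p : ℝ) - 1)) ≤ exp 2 * W := by
  have hW : 0 ≤ W := by simpa using (sum_nonneg fun s _ => hw0 s).trans (hw 1 one_pos)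
  set Q := {p ∈ Icc 1 M | p.Prime} with hQ
  have hnn : ∀ P ∈ Q.powerset, 0 ≤ ∏ p ∈ P, 2 / ((p : ℝ) - 1) := fun P hP =>
    prod_nonneg fun p hp => by
      have : (1 : ℝ) < p := by
        exact_mod_cast (mem_filter.1 (mem_powerset.1 hP hp)).2.one_lt
      have : (0 : ℝ) < (p : ℝ) - 1 := by linarith
      positivity
  calc ∑ s ∈ Icc 1 M, w s * ∏ p ∈ s.primeFactors, (1 + 2 / ((p : ℝ) - 1))
      = ∑ s ∈ Icc 1 M, ∑ P ∈ Q.powerset,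
          if P ⊆ s.primeFactors then (∏ p ∈ P, 2 / ((p : ℝ) - 1)) * w s else 0 := by
        refine sum_congr rfl fun s hs => ?_
        rw [prod_one_add, ← sum_filter, mul_sum]
        refine sum_congr ?_ fun P _ => mul_comm _ _
        ext P
        simp only [mem_powerset, mem_filter, iff_and_self]
        intro h p hp
        have hps := h hp
        have h1 := Nat.prime_of_mem_primeFactors hps
        rw [hQ, mem_filter, mem_Icc]
        exact ⟨⟨h1.one_lt.le, (Nat.le_of_mem_primeFactors hps).trans (mem_Icc.1 hs).2⟩, h1⟩
    _ = ∑ P ∈ Q.powerset, (∏ p ∈ P, 2 / ((p : ℝ) - 1)) *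
          ∑ s ∈ Icc 1 M with P ⊆ s.primeFactors, w s := by
        rw [sum_comm]
        simp_rw [mul_sum, sum_filter]
    _ ≤ ∑ P ∈ Q.powerset, (∏ p ∈ P, 2 / ((p : ℝ) - 1)) * (W / (∏ p ∈ P, p : ℕ)) := by
        refine sum_le_sum fun P hP => mul_le_mul_of_nonneg_left ?_ (hnn P hP)
        have hpr : ∀ p ∈ P, p.Prime := fun p hp => (mem_filter.1 (mem_powerset.1 hP hp)).2
        refine le_trans (sum_le_sum_of_subset_of_nonneg ?_ fun s _ _ => hw0 s)
          (hw _ (prod_pos fun p hp => (hpr p hp).pos))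
        intro s hs
        rw [mem_filter] at hs ⊢
        exact ⟨hs.1, (prod_dvd_prod_of_subset _ _ _ hs.2).trans (Nat.prod_primeFactors_dvd s)⟩
    _ = W * ∏ p ∈ Q, (1 + 2 / ((p : ℝ) - 1) / p) := by
        rw [prod_one_add, mul_sum]
        refine sum_congr rfl fun P _ => ?_
        rw [prod_div_distrib (g := fun p : ℕ => (p : ℝ))]
        push_cast
        ring
    _ ≤ exp 2 * W := by
        rw [mul_comm]
        exact mul_le_mul_of_nonneg_right (prod_primes_one_add_le_exp_two M) hW

theorem sum_prod_primeFactors_le (R : ℝ) (hR : 0 ≤ R) :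
    ∑ r ∈ Icc 1 ⌊R⌋₊, ∏ p ∈ r.primeFactors, (1 + 2 / ((p : ℝ) - 1)) ≤ exp 2 * R := by
  have := sum_mul_prod_primeFactors_le ⌊R⌋₊ (fun _ => 1) R (fun d hd => ?_) fun _ => zero_le_one
  · simpa using this
  · have hcard : #{s ∈ Icc 1 ⌊R⌋₊ | d ∣ s} = ⌊R⌋₊ / d := Nat.Ioc_filter_dvd_card_eq_div ⌊R⌋₊ d
    rw [sum_const, nsmul_one, hcard]
    exact Nat.cast_div_le.trans (by gcongr; exact Nat.floor_le hR)

theorem cast_div_totient_eq_prod {n : ℕ} (hn : n ≠ 0) :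
    (n : ℝ) / n.totient = ∏ p ∈ n.primeFactors, (1 + 1 / ((p : ℝ) - 1)) := by
  have hpr : ∀ p ∈ n.primeFactors, (1 : ℝ) < p := fun p hp => by
    exact_mod_cast (Nat.prime_of_mem_primeFactors hp).one_lt
  have h0 : (∏ p ∈ n.primeFactors, ((p : ℝ) - 1)) ≠ 0 :=
    prod_ne_zero_iff.2 fun p hp => by linarith [hpr p hp]
  have key : (n.totient : ℝ) * ∏ p ∈ n.primeFactors, (p : ℝ) =
      n * ∏ p ∈ n.primeFactors, ((p : ℝ) - 1) := by
    have := congrArg (Nat.cast (R := ℝ)) (Nat.totient_mul_prod_primeFactors n)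
    push_cast at this
    rw [this]
    congr 1
    exact prod_congr rfl fun p hp => Nat.cast_pred (Nat.pos_of_mem_primeFactors hp)
  have hφ : (n.totient : ℝ) ≠ 0 := by
    exact_mod_cast (Nat.totient_pos.2 (Nat.pos_of_ne_zero hn)).ne'
  have hprod : ∏ p ∈ n.primeFactors, (1 + 1 / ((p : ℝ) - 1)) =
      (∏ p ∈ n.primeFactors, (p : ℝ)) / ∏ p ∈ n.primeFactors, ((p : ℝ) - 1) := by
    rw [← prod_div_distrib]
    refine prod_congr rfl fun p hp => ?_
    have : (p : ℝ) - 1 ≠ 0 := by linarith [hpr p hp]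
    field_simp
    ring
  rw [hprod, div_eq_div_iff hφ h0, ← key, mul_comm]

theorem cast_totient_of_squarefree {n : ℕ} (hn : Squarefree n) :
    (n.totient : ℝ) = ∏ p ∈ n.primeFactors, ((p : ℝ) - 1) := by
  have h := Nat.totient_mul_prod_primeFactors n
  rw [Nat.prod_primeFactors_of_squarefree hn, mul_comm] at h
  rw [Nat.eq_of_mul_eq_mul_left (Nat.pos_of_ne_zero hn.ne_zero) h, Nat.cast_prod]
  exact prod_congr rfl fun p hp => Nat.cast_pred (Nat.pos_of_mem_primeFactors hp)

theorem sum_one_div_filter_dvd_le (M d : ℕ) (hd : 0 < d) :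
    ∑ s ∈ Icc 1 M with d ∣ s, 1 / (s : ℝ) ≤ (∑ s ∈ Icc 1 M, 1 / (s : ℝ)) / d := by
  have himage : {s ∈ Icc 1 M | d ∣ s} ⊆ (Icc 1 M).image (d * ·) := by
    intro s hs
    simp only [mem_filter, mem_Icc, mem_image] at hs ⊢
    obtain ⟨⟨h1, h2⟩, m, rfl⟩ := hs
    exact ⟨m, ⟨Nat.pos_of_mul_pos_left h1, (Nat.le_mul_of_pos_left m hd).trans h2⟩, rfl⟩
  calc _ ≤ ∑ s ∈ (Icc 1 M).image (d * ·), 1 / (s : ℝ) :=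
        sum_le_sum_of_subset_of_nonneg himage fun _ _ _ => by positivity
    _ = _ := by
      rw [sum_image fun m _ m' _ h => Nat.eq_of_mul_eq_mul_left hd h, sum_div]
      refine sum_congr rfl fun m _ => ?_
      push_cast
      rw [div_div, mul_comm]

theorem sum_one_div_totient_le {N : ℝ} (hN : 1 ≤ N) :
    ∑ s ∈ Icc 1 ⌊N⌋₊, 1 / (s.totient : ℝ) ≤ exp 2 * (1 + log N) := by
  have hH : ∑ s ∈ Icc 1 ⌊N⌋₊, 1 / (s : ℝ) ≤ 1 + log N := by
    have h := harmonic_floor_le_one_add_log N hN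
    rw [harmonic_eq_sum_Icc] at h
    push_cast at h
    simpa only [one_div] using h
  calc ∑ s ∈ Icc 1 ⌊N⌋₊, 1 / (s.totient : ℝ)
      ≤ ∑ s ∈ Icc 1 ⌊N⌋₊, 1 / (s : ℝ) * ∏ p ∈ s.primeFactors, (1 + 2 / ((p : ℝ) - 1)) := by
        refine sum_le_sum fun s hs => ?_
        have hs0 : s ≠ 0 := by have := (mem_Icc.1 hs).1; omega
        have hs' : (s : ℝ) ≠ 0 := by exact_mod_cast hs0
        have : 1 / (s.totient : ℝ) = 1 / s * (s / s.totient) := by field_simp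
        rw [this, cast_div_totient_eq_prod hs0]
        have hp : ∀ p ∈ s.primeFactors, (0 : ℝ) < (p : ℝ) - 1 := fun p hp => by
          have : (1 : ℝ) < p := by exact_mod_cast (Nat.prime_of_mem_primeFactors hp).one_lt
          linarith
        refine mul_le_mul_of_nonneg_left (prod_le_prod (fun p h => ?_) fun p h => ?_) (by positivity)
        · have := hp p h
          positivity
        · have := hp p h
          gcongr
          norm_num
    _ ≤ exp 2 * ∑ s ∈ Icc 1 ⌊N⌋₊, 1 / (s : ℝ) :=
        sum_mul_prod_primeFactors_le _ _ _ (sum_one_div_filter_dvd_le _) fun _ => by positivity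
    _ ≤ _ := by gcongr

theorem FR_eq_sum_prod (R : ℝ) (n : ℤ) :
    FR R n = ∑ r ∈ Icc 1 ⌊R⌋₊ with Squarefree r,
      (∏ p ∈ r.primeFactors, 1 / ((p : ℝ) - 1)) *
        ∏ p ∈ r.primeFactors, (if (p : ℤ) ∣ n then 1 - (p : ℝ) else 1) := by
  rw [FR, sum_filter]
  refine sum_congr rfl fun r hr => ?_
  split_ifs with hsq
  · have hg : Squarefree (Int.gcd r n) :=
      hsq.squarefree_of_dvd (Int.natCast_dvd_natCast.1 (Int.gcd_dvd_left ..))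
    have hpf : (Int.gcd r n).primeFactors = r.primeFactors.filter (fun p : ℕ => (p : ℤ) ∣ n) := by
      ext p
      simp only [Nat.mem_primeFactors, mem_filter, ← Int.natCast_dvd_natCast, Int.dvd_coe_gcd_iff]
      simp only [ne_eq, Int.gcd_eq_zero_iff, Nat.cast_eq_zero, hsq.ne_zero, not_false_eq_true,
        false_and, and_true]
      tauto
    rw [← prod_filter, ← hpf, ← Int.cast_pow,
      ArithmeticFunction.moebius_sq_eq_one_of_squarefree hsq,
      ArithmeticFunction.moebius_apply_of_squarefree hg, cast_totient_of_squarefree hg,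
      cast_totient_of_squarefree hsq,
      ← (ArithmeticFunction.cardDistinctFactors_eq_cardFactors_iff_squarefree hg.ne_zero).2 hg,
      ArithmeticFunction.cardDistinctFactors_apply, ← List.card_toFinset]
    change (1 : ℤ) * (((-1) ^ #(Int.gcd r n).primeFactors : ℤ) : ℝ) * _ / _ = _
    push_cast
    rw [← prod_const, one_mul, ← prod_mul_distrib, prod_div_distrib, prod_const_one, div_eq_mul_inv,
      one_div, mul_comm]
    congr 1
    exact prod_congr rfl fun p _ => by ring
  · simp [ArithmeticFunction.moebius_eq_zero_of_not_squarefree hsq]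

/-- The mean over `q` coprime to `a` of the factor at `p` of a squarefree `r` divisible by `p`:
`1 - p` if `p ∣ a + q s` and `1` otherwise. -/
noncomputable def localMean (a : ℤ) (s p : ℕ) : ℝ :=
  if (p : ℤ) ∣ a then (if p ∣ s then 1 - (p : ℝ) else 1) else if p ∣ s then 1 else 0

theorem exists_forall_dvd_add_mul_iff {p : ℕ} (hp : p.Prime) (a : ℤ) {s : ℕ} (hs : ¬ p ∣ s) :
    ∃ c : ℕ, ∀ q : ℕ, (p : ℤ) ∣ a + q * s ↔ q ≡ c [MOD p] := by
  have := Fact.mk hp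
  have hs' : (s : ZMod p) ≠ 0 := fun h => hs ((ZMod.natCast_eq_zero_iff s p).1 h)
  refine ⟨(-(a : ZMod p) / s).val, fun q => ?_⟩
  rw [← ZMod.intCast_zmod_eq_zero_iff_dvd, ← ZMod.natCast_eq_natCast_iff, ZMod.natCast_zmod_val,
    eq_div_iff hs']
  push_cast
  exact ⟨fun h => by linear_combination h, fun h => by linear_combination h⟩

theorem exists_local_factor {p : ℕ} (hp : p.Prime) (a : ℤ) (r s : ℕ) :
    ∃ (c : ℕ) (α β : ℝ),
      (∀ q : ℕ, (if (p : ℤ) ∣ a then (if p ∣ q then 0 else 1) else (1 : ℝ)) *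
          (if p ∣ r then (if (p : ℤ) ∣ a + q * s then 1 - (p : ℝ) else 1) else 1) =
        β * (if q ≡ c [MOD p] then 1 else 0) + α) ∧
      β / p + α = (if (p : ℤ) ∣ a then 1 - 1 / (p : ℝ) else 1) *
        (if p ∣ r then localMean a s p else 1) ∧
      |β| + |α| ≤ (if (p : ℤ) ∣ a then 2 else 1) * (if p ∣ r then (p : ℝ) + 1 else 1) := by
  have hp1 : (1 : ℝ) < p := by exact_mod_cast hp.one_lt
  have hp0 : (p : ℝ) ≠ 0 := by linarith
  have habs : |(p : ℝ) - 1| = p - 1 := abs_of_pos (by linarith)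
  have habs' : |1 - (p : ℝ)| = p - 1 := by rw [abs_sub_comm, habs]
  have hzero : ∀ q : ℕ, q ≡ 0 [MOD p] ↔ p ∣ q := fun q => Nat.modEq_zero_iff_dvd
  have hpint : Prime (p : ℤ) := Nat.prime_iff_prime_int.1 hp
  unfold localMean
  by_cases ha : (p : ℤ) ∣ a <;> by_cases hr : p ∣ r <;> by_cases hs : p ∣ s
  · refine ⟨0, 1 - p, p - 1, fun q => ?_, ?_, ?_⟩
    · have : (p : ℤ) ∣ a + q * s :=
        dvd_add ha ((Int.natCast_dvd_natCast.2 hs).mul_left _)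
      by_cases hq : p ∣ q <;> simp [*]
    · simp only [ha, hr, hs, if_true]
      field_simp
      ring
    · simp only [ha, hr, if_true, habs, habs']
      linarith
  · refine ⟨0, 1, -1, fun q => ?_, ?_, ?_⟩
    · have : (p : ℤ) ∣ a + q * s ↔ p ∣ q := by
        rw [dvd_add_right ha, hpint.dvd_mul, Int.natCast_dvd_natCast, Int.natCast_dvd_natCast]
        tauto
      by_cases hq : p ∣ q <;> simp [*]
    · simp only [ha, hr, hs, if_true, if_false]
      ring
    · simp only [ha, hr, if_true, abs_neg, abs_one]
      linarith
  · refine ⟨0, 1, -1, fun q => ?_, ?_, ?_⟩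
    · by_cases hq : p ∣ q <;> simp [*]
    · simp only [ha, hr, if_true, if_false]
      ring
    · simp only [ha, hr, if_true, if_false, abs_neg, abs_one]
      linarith
  · refine ⟨0, 1, -1, fun q => ?_, ?_, ?_⟩
    · by_cases hq : p ∣ q <;> simp [*]
    · simp only [ha, hr, if_true, if_false]
      ring
    · simp only [ha, hr, if_true, if_false, abs_neg, abs_one]
      linarith
  · refine ⟨0, 1, 0, fun q => ?_, ?_, ?_⟩
    · have : ¬ (p : ℤ) ∣ a + q * s := fun h =>
        ha ((dvd_add_left ((Int.natCast_dvd_natCast.2 hs).mul_left _)).1 h)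
      simp [*]
    · simp [*]
    · simp [*]
  · obtain ⟨c, hc⟩ := exists_forall_dvd_add_mul_iff hp a hs
    refine ⟨c, 1, -p, fun q => ?_, ?_, ?_⟩
    · by_cases hq : q ≡ c [MOD p]
      · simp [*]
        ring
      · simp [*]
    · simp only [ha, hr, hs, if_true, if_false]
      field_simp
      ring
    · simp [*]
  · exact ⟨0, 1, 0, fun q => by simp [*], by simp [*], by simp [*]⟩
  · exact ⟨0, 1, 0, fun q => by simp [*], by simp [*], by simp [*]⟩

theorem prod_ite_dvd_int {a : ℤ} (ha : a ≠ 0) {P : Finset ℕ} (hP : ∀ p ∈ P, p.Prime)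
    (haP : a.natAbs.primeFactors ⊆ P) (f : ℕ → ℝ) :
    ∏ p ∈ P, (if (p : ℤ) ∣ a then f p else 1) = ∏ p ∈ a.natAbs.primeFactors, f p := by
  rw [← prod_filter]
  congr 1
  ext p
  rw [mem_filter, Nat.mem_primeFactors, ← Int.natCast_dvd]
  exact ⟨fun h => ⟨hP p h.1, h.2, Int.natAbs_ne_zero.2 ha⟩,
    fun h => ⟨haP (Nat.mem_primeFactors.2 ⟨h.1, Int.natCast_dvd.1 h.2.1, h.2.2⟩), h.2.1⟩⟩

theorem prod_ite_dvd_nat {r : ℕ} (hr : r ≠ 0) {P : Finset ℕ} (hP : ∀ p ∈ P, p.Prime)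
    (hrP : r.primeFactors ⊆ P) (f : ℕ → ℝ) :
    ∏ p ∈ P, (if p ∣ r then f p else 1) = ∏ p ∈ r.primeFactors, f p := by
  simpa [Int.natCast_dvd_natCast] using
    prod_ite_dvd_int (a := r) (by exact_mod_cast hr) hP (by simpa using hrP) f

theorem abs_sum_coprime_prod_sub_le {a : ℤ} (ha : a ≠ 0) {r : ℕ} (hr : r ≠ 0) (s u v : ℕ) {L : ℝ}
    (hL : |((v - u : ℕ) : ℝ) - L| ≤ 1) :
    |∑ q ∈ (Ioc u v).filter (fun q : ℕ => Int.gcd (q : ℤ) a = 1),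
          ∏ p ∈ r.primeFactors, (if (p : ℤ) ∣ a + (q : ℤ) * (s : ℤ) then 1 - (p : ℝ) else 1)
        - L * ((∏ p ∈ a.natAbs.primeFactors, (1 - 1 / (p : ℝ))) *
            ∏ p ∈ r.primeFactors, localMean a s p)|
      ≤ 2 * (2 ^ #a.natAbs.primeFactors * ∏ p ∈ r.primeFactors, ((p : ℝ) + 1)) := by
  set P := a.natAbs.primeFactors ∪ r.primeFactors with hPdef
  have hP : ∀ p ∈ P, p.Prime := fun p hp =>
    (mem_union.1 hp).elim Nat.prime_of_mem_primeFactors Nat.prime_of_mem_primeFactors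
  have haP : a.natAbs.primeFactors ⊆ P := subset_union_left
  have hrP : r.primeFactors ⊆ P := subset_union_right
  have hloc : ∀ p : ℕ, ∃ (c : ℕ) (α β : ℝ), p ∈ P →
      (∀ q : ℕ, (if (p : ℤ) ∣ a then (if p ∣ q then 0 else 1) else (1 : ℝ)) *
          (if p ∣ r then (if (p : ℤ) ∣ a + q * s then 1 - (p : ℝ) else 1) else 1) =
        β * (if q ≡ c [MOD p] then 1 else 0) + α) ∧
      β / p + α = (if (p : ℤ) ∣ a then 1 - 1 / (p : ℝ) else 1) *
        (if p ∣ r then localMean a s p else 1) ∧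
      |β| + |α| ≤ (if (p : ℤ) ∣ a then 2 else 1) * (if p ∣ r then (p : ℝ) + 1 else 1) := by
    intro p
    by_cases hp : p ∈ P
    · obtain ⟨c, α, β, h⟩ := exists_local_factor (hP p hp) a r s
      exact ⟨c, α, β, fun _ => h⟩
    · exact ⟨0, 0, 0, fun h => absurd h hp⟩
  choose c α β h using hloc
  have hmaster := abs_sum_prod_residue_sub_le P hP c α β u v L hL
  have hmean : ∏ p ∈ P, (β p / p + α p) =
      (∏ p ∈ a.natAbs.primeFactors, (1 - 1 / (p : ℝ))) *
        ∏ p ∈ r.primeFactors, localMean a s p := by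
    rw [prod_congr rfl fun p hp => (h p hp).2.1, prod_mul_distrib, prod_ite_dvd_int ha hP haP,
      prod_ite_dvd_nat hr hP hrP]
  have hbound : ∏ p ∈ P, (|β p| + |α p|) ≤
      2 ^ #a.natAbs.primeFactors * ∏ p ∈ r.primeFactors, ((p : ℝ) + 1) := by
    refine (prod_le_prod (fun p _ => by positivity) fun p hp => (h p hp).2.2).trans_eq ?_
    rw [prod_mul_distrib, prod_ite_dvd_int ha hP haP, prod_ite_dvd_nat hr hP hrP, prod_const]
  have hsum : ∑ q ∈ (Ioc u v).filter (fun q : ℕ => Int.gcd (q : ℤ) a = 1),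
        ∏ p ∈ r.primeFactors, (if (p : ℤ) ∣ a + (q : ℤ) * (s : ℤ) then 1 - (p : ℝ) else 1) =
      ∑ q ∈ Ioc u v, ∏ p ∈ P, (β p * (if q ≡ c p [MOD p] then 1 else 0) + α p) := by
    rw [sum_filter]
    refine sum_congr rfl fun q _ => ?_
    rw [prod_congr rfl fun p hp => ((h p hp).1 q).symm, prod_mul_distrib,
      prod_ite_dvd_int ha hP haP, prod_ite_dvd_nat hr hP hrP]
    split_ifs with hq
    · rw [prod_eq_one (f := fun p => if p ∣ q then (0 : ℝ) else 1), one_mul]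
      intro p hp
      rw [if_neg]
      intro hpq
      have hdvd : p ∣ Int.gcd (q : ℤ) a := Nat.dvd_gcd hpq (Nat.dvd_of_mem_primeFactors hp)
      exact (Nat.prime_of_mem_primeFactors hp).one_lt.ne' (Nat.dvd_one.1 (hq ▸ hdvd))
    · obtain ⟨p, hp, hpd⟩ := Nat.exists_prime_and_dvd hq
      rw [prod_eq_zero (i := p), zero_mul]
      · exact Nat.mem_primeFactors.2
          ⟨hp, hpd.trans (Nat.gcd_dvd_right ..), Int.natAbs_ne_zero.2 ha⟩
      · exact if_pos (hpd.trans (Nat.gcd_dvd_left ..))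
  rw [hsum, ← hmean]
  exact hmaster.trans (by gcongr)

/-- The mean of `F_R(a + q s)` over `q` coprime to `a`. -/
noncomputable def meanFR (R : ℝ) (a : ℤ) (s : ℕ) : ℝ :=
  (∏ p ∈ a.natAbs.primeFactors, (1 - 1 / (p : ℝ))) *
    ∑ r ∈ Icc 1 ⌊R⌋₊ with Squarefree r, ∏ p ∈ r.primeFactors, localMean a s p / ((p : ℝ) - 1)

theorem abs_sum_FR_sub_le {R : ℝ} (hR : 0 ≤ R) {a : ℤ} (ha : a ≠ 0) (s u v : ℕ) {L : ℝ}
    (hL : |((v - u : ℕ) : ℝ) - L| ≤ 1) :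
    |∑ q ∈ (Ioc u v).filter (fun q : ℕ => Int.gcd (q : ℤ) a = 1),
          FR R (a + (q : ℤ) * (s : ℤ)) - L * meanFR R a s|
      ≤ 2 * exp 2 * 2 ^ #a.natAbs.primeFactors * R := by
  simp_rw [FR_eq_sum_prod, meanFR]
  rw [sum_comm, mul_sum, mul_sum, ← sum_sub_distrib]
  have hpos : ∀ r : ℕ, ∀ p ∈ r.primeFactors, (0 : ℝ) < (p : ℝ) - 1 := fun r p hp => by
    have : (1 : ℝ) < p := by exact_mod_cast (Nat.prime_of_mem_primeFactors hp).one_lt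
    linarith
  calc _ ≤ ∑ r ∈ Icc 1 ⌊R⌋₊ with Squarefree r,
        2 * 2 ^ #a.natAbs.primeFactors * ∏ p ∈ r.primeFactors, (1 + 2 / ((p : ℝ) - 1)) := by
        refine (abs_sum_le_sum_abs _ _).trans (sum_le_sum fun r hr => ?_)
        have hnn : 0 ≤ ∏ p ∈ r.primeFactors, 1 / ((p : ℝ) - 1) :=
          prod_nonneg fun p hp => (one_div_pos.2 (hpos r p hp)).le
        have hsplit : ∏ p ∈ r.primeFactors, localMean a s p / ((p : ℝ) - 1) =
            (∏ p ∈ r.primeFactors, 1 / ((p : ℝ) - 1)) * ∏ p ∈ r.primeFactors, localMean a s p := by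
          rw [← prod_mul_distrib]
          exact prod_congr rfl fun p _ => by ring
        have hfac : ∏ p ∈ r.primeFactors, (1 + 2 / ((p : ℝ) - 1)) =
            (∏ p ∈ r.primeFactors, 1 / ((p : ℝ) - 1)) * ∏ p ∈ r.primeFactors, ((p : ℝ) + 1) := by
          rw [← prod_mul_distrib]
          refine prod_congr rfl fun p hp => ?_
          have := (hpos r p hp).ne'
          field_simp
          ring
        rw [hsplit, hfac, ← mul_sum, mul_left_comm _ (∏ p ∈ r.primeFactors, 1 / ((p : ℝ) - 1)),
          mul_left_comm L, ← mul_sub, abs_mul, abs_of_nonneg hnn, mul_left_comm (2 * 2 ^ _),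
          mul_assoc 2]
        exact mul_le_mul_of_nonneg_left
          (abs_sum_coprime_prod_sub_le ha (mem_filter.1 hr).2.ne_zero s u v hL) hnn
    _ ≤ ∑ r ∈ Icc 1 ⌊R⌋₊,
        2 * 2 ^ #a.natAbs.primeFactors * ∏ p ∈ r.primeFactors, (1 + 2 / ((p : ℝ) - 1)) := by
        refine sum_le_sum_of_subset_of_nonneg (filter_subset _ _) fun r _ _ => ?_
        have : 0 ≤ ∏ p ∈ r.primeFactors, (1 + 2 / ((p : ℝ) - 1)) := prod_nonneg fun p hp => by
          have := hpos r p hp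
          positivity
        positivity
    _ ≤ _ := by
        rw [← mul_sum]
        calc _ ≤ 2 * 2 ^ #a.natAbs.primeFactors * (exp 2 * R) := by
              gcongr
              exact sum_prod_primeFactors_le R hR
          _ = _ := by ring

theorem localMean_eq_zero {a : ℤ} (ha : a ≠ 0) {s : ℕ} (hs : s ≠ 0) {p : ℕ} (hp : p.Prime)
    (h : p ∉ a.natAbs.primeFactors ∪ s.primeFactors) : localMean a s p = 0 := by
  simp only [mem_union, Nat.mem_primeFactors, ← Int.natCast_dvd, not_or] at h
  have ha' : ¬ (p : ℤ) ∣ a := fun hd => h.1 ⟨hp, hd, Int.natAbs_ne_zero.2 ha⟩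
  have hs' : ¬ p ∣ s := fun hd => h.2 ⟨hp, hd, hs⟩
  simp [localMean, ha', hs']

theorem prod_one_sub_inv_mul_prod (n : ℕ) :
    (∏ p ∈ n.primeFactors, (1 - 1 / (p : ℝ))) * ∏ p ∈ n.primeFactors, (1 + 1 / ((p : ℝ) - 1)) =
      1 := by
  rw [← prod_mul_distrib]
  refine prod_eq_one fun p hp => ?_
  have : (1 : ℝ) < p := by exact_mod_cast (Nat.prime_of_mem_primeFactors hp).one_lt
  have : (p : ℝ) - 1 ≠ 0 := by linarith
  have : (p : ℝ) ≠ 0 := by linarith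
  field_simp
  ring

theorem meanFR_eq_mul_prod {R : ℝ} {a : ℤ} (ha : a ≠ 0) {s : ℕ} (hs : s ≠ 0)
    (hR : a.natAbs * s ≤ ⌊R⌋₊) :
    meanFR R a s = (∏ p ∈ a.natAbs.primeFactors, (1 - 1 / (p : ℝ))) *
      ∏ p ∈ a.natAbs.primeFactors ∪ s.primeFactors, (1 + localMean a s p / ((p : ℝ) - 1)) := by
  have hpf := Nat.primeFactors_mul (Int.natAbs_ne_zero.2 ha) hs
  rw [meanFR, sum_squarefree_prod_eq (mul_ne_zero (Int.natAbs_ne_zero.2 ha) hs) hR _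
    fun p hp hpK => ?_, hpf]
  rw [localMean_eq_zero ha hs hp (hpf ▸ hpK), zero_div]

theorem meanFR_of_coprime {R : ℝ} {a : ℤ} (ha : a ≠ 0) {s : ℕ} (hs : s ≠ 0)
    (hR : a.natAbs * s ≤ ⌊R⌋₊) (hsa : Int.gcd (s : ℤ) a = 1) :
    meanFR R a s = (s : ℝ) / s.totient := by
  have hco : Nat.Coprime a.natAbs s := Nat.Coprime.symm hsa
  rw [meanFR_eq_mul_prod ha hs hR, prod_union hco.disjoint_primeFactors, ← mul_assoc,
    prod_congr (s₁ := a.natAbs.primeFactors) (f := fun p => 1 + localMean a s p / ((p : ℝ) - 1))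
      (g := fun p => 1 + 1 / ((p : ℝ) - 1)) rfl fun p hp => ?_,
    prod_one_sub_inv_mul_prod, one_mul, cast_div_totient_eq_prod hs]
  · refine prod_congr rfl fun p hp => ?_
    have hpa : ¬ (p : ℤ) ∣ a := fun h => Finset.disjoint_left.1 hco.disjoint_primeFactors
      (Nat.mem_primeFactors.2 ⟨Nat.prime_of_mem_primeFactors hp, Int.natCast_dvd.1 h,
        Int.natAbs_ne_zero.2 ha⟩) hp
    simp [localMean, hpa, Nat.dvd_of_mem_primeFactors hp]
  · have hpa : (p : ℤ) ∣ a := Int.natCast_dvd.2 (Nat.dvd_of_mem_primeFactors hp)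
    have hps : ¬ p ∣ s := fun h => Finset.disjoint_left.1 hco.disjoint_primeFactors hp
      (Nat.mem_primeFactors.2 ⟨Nat.prime_of_mem_primeFactors hp, h, hs⟩)
    simp [localMean, hpa, hps]

theorem meanFR_of_not_coprime {R : ℝ} {a : ℤ} (ha : a ≠ 0) {s : ℕ} (hs : s ≠ 0)
    (hR : a.natAbs * s ≤ ⌊R⌋₊) (hsa : Int.gcd (s : ℤ) a ≠ 1) : meanFR R a s = 0 := by
  obtain ⟨p, hp, hpd⟩ := Nat.exists_prime_and_dvd hsa
  have hps : p ∣ s := hpd.trans (Nat.gcd_dvd_left ..)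
  have hpa : p ∣ a.natAbs := hpd.trans (Nat.gcd_dvd_right ..)
  rw [meanFR_eq_mul_prod ha hs hR, prod_eq_zero (i := p)
    (mem_union_right _ (Nat.mem_primeFactors.2 ⟨hp, hps, hs⟩)), mul_zero]
  have : (1 : ℝ) < p := by exact_mod_cast hp.one_lt
  have : (p : ℝ) - 1 ≠ 0 := by linarith
  simp only [localMean, Int.natCast_dvd.2 hpa, hps, if_true]
  field_simp
  ring

theorem abs_meanFR_le (R : ℝ) {a : ℤ} (ha : a ≠ 0) {s : ℕ} (hs : s ≠ 0) :
    |meanFR R a s| ≤ 2 ^ #a.natAbs.primeFactors * ((s : ℝ) / s.totient) := by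
  set P := a.natAbs.primeFactors ∪ s.primeFactors with hPdef
  have hP : ∀ p ∈ P, p.Prime := fun p hp =>
    (mem_union.1 hp).elim Nat.prime_of_mem_primeFactors Nat.prime_of_mem_primeFactors
  have hnn : 0 ≤ ∏ p ∈ a.natAbs.primeFactors, (1 - 1 / (p : ℝ)) := prod_nonneg fun p hp => by
    have : (1 : ℝ) < p := by exact_mod_cast (Nat.prime_of_mem_primeFactors hp).one_lt
    rw [sub_nonneg, div_le_one] <;> linarith
  have hprod : ∏ p ∈ P, (1 + |localMean a s p / ((p : ℝ) - 1)|) ≤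
      (∏ p ∈ a.natAbs.primeFactors, 2 * (1 + 1 / ((p : ℝ) - 1))) *
        ∏ p ∈ s.primeFactors, (1 + 1 / ((p : ℝ) - 1)) := by
    rw [← prod_ite_dvd_int ha hP subset_union_left, ← prod_ite_dvd_nat hs hP subset_union_right,
      ← prod_mul_distrib]
    refine prod_le_prod (fun p _ => by positivity) fun p hp => ?_
    have hp1 : (0 : ℝ) < p - 1 := by
      have : (1 : ℝ) < p := by exact_mod_cast (hP p hp).one_lt
      linarith
    have hinv : 0 < 1 / ((p : ℝ) - 1) := one_div_pos.2 hp1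
    unfold localMean
    split_ifs
    · rw [show (1 - (p : ℝ)) / (p - 1) = -1 by field_simp; ring, abs_neg, abs_one]
      nlinarith
    · rw [abs_of_pos hinv]
      linarith
    · rw [abs_of_pos hinv]
      linarith
    · simp
  rw [meanFR, abs_mul, abs_of_nonneg hnn]
  calc _ ≤ _ := mul_le_mul_of_nonneg_left ((abs_sum_squarefree_prod_le _ P _ fun p hp hpP => by
        rw [localMean_eq_zero ha hs hp hpP, zero_div]).trans hprod) hnn
    _ = 2 ^ #a.natAbs.primeFactors * ((s : ℝ) / s.totient) *
        ((∏ p ∈ a.natAbs.primeFactors, (1 - 1 / (p : ℝ))) *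
          ∏ p ∈ a.natAbs.primeFactors, (1 + 1 / ((p : ℝ) - 1))) := by
        rw [prod_mul_distrib, prod_const, cast_div_totient_eq_prod hs]
        ring
    _ = _ := by rw [prod_one_sub_inv_mul_prod, mul_one]

/-- Writing `n = a + q s` in the definition of `ρ_R^*(x; q, a)`. -/
theorem rhoStar_eq_sum {R x N : ℝ} (hx : 0 < x) (hN : 0 < N) {a : ℤ} (haN : |(a : ℝ)| < x / N)
    {q : ℕ} (hq : ⌊x / N⌋₊ < q) :
    rhoStar R x q a = ∑ s ∈ (Icc 1 (⌊N⌋₊ + 1)).filter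
      (fun s : ℕ => (a : ℝ) + q * s ≤ x), FR R (a + (q : ℤ) * (s : ℤ)) := by
  have hqN : x / N < q := (Nat.floor_lt (by positivity)).1 hq
  have hq0 : (0 : ℝ) < q := lt_of_le_of_lt (by positivity) hqN
  have hqz : (0 : ℤ) < q := by exact_mod_cast hq0
  have haq : |a| < (q : ℤ) := by exact_mod_cast haN.trans hqN
  have hle : ∀ n : ℕ, n ≤ ⌊x⌋₊ ↔ (n : ℝ) ≤ x := fun n => Nat.le_floor_iff hx.le
  have hpos : ∀ s : ℕ, 1 ≤ s → 0 < a + (q : ℤ) * s := fun s hs => by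
    have : (q : ℤ) * 1 ≤ q * s := by gcongr; exact_mod_cast hs
    linarith [neg_abs_le a]
  refine (sum_of_injOn (fun s : ℕ => (a + (q : ℤ) * s).toNat) ?_ ?_ ?_ ?_).symm
  · intro s hs s' hs' h
    simp only [coe_filter, mem_Icc, Set.mem_ofPred_eq] at hs hs'
    have h1 := hpos s hs.1.1
    have h2 := hpos s' hs'.1.1
    have h3 : a + (q : ℤ) * s = a + (q : ℤ) * s' := by
      rw [← Int.toNat_of_nonneg h1.le, ← Int.toNat_of_nonneg h2.le]
      exact congrArg _ h
    exact_mod_cast mul_left_cancel₀ hqz.ne' (add_left_cancel h3)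
  · intro s hs
    simp only [coe_filter, mem_Icc, Set.mem_ofPred_eq] at hs ⊢
    have h1 := hpos s hs.1.1
    have h2 : (((a + (q : ℤ) * s).toNat : ℕ) : ℤ) = a + q * s := Int.toNat_of_nonneg h1.le
    have h3 : (((a + (q : ℤ) * s).toNat : ℕ) : ℝ) = a + q * s := by exact_mod_cast h2
    rw [hle, h3, h2]
    refine ⟨⟨by omega, hs.2⟩, ?_, ⟨s, by ring⟩⟩
    have : 0 < (q : ℤ) * s := mul_pos hqz (by exact_mod_cast hs.1.1)
    linarith
  · intro n hn hn'
    exfalso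
    simp only [mem_filter, mem_Icc, hle] at hn
    obtain ⟨⟨hn1, hnx⟩, han, m, hm⟩ := hn
    have hm0 : 0 < m := pos_of_mul_pos_right (hm ▸ sub_pos.2 han) hqz.le
    lift m to ℕ using hm0.le
    have hn2 : (n : ℤ) = a + q * m := by linarith
    have hn3 : (n : ℝ) = a + q * m := by exact_mod_cast hn2
    refine hn' ⟨m, ?_, ?_⟩
    · simp only [coe_filter, mem_Icc, Set.mem_ofPred_eq]
      refine ⟨⟨by exact_mod_cast hm0, ?_⟩, hn3 ▸ hnx⟩
      have hm0' : (0 : ℝ) < m := by exact_mod_cast hm0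
      have h4 : (x / N) * m < x + x / N := by
        have := mul_lt_mul_of_pos_right hqN hm0'
        linarith [neg_abs_le (a : ℝ)]
      have h5 : x / N * m < x / N * (N + 1) := by
        rw [mul_add, div_mul_cancel₀ _ hN.ne', mul_one]
        exact h4
      have h6 : (m : ℝ) < N + 1 := lt_of_mul_lt_mul_left h5 (by positivity)
      have h7 : m < ⌊N⌋₊ + 1 + 1 := by
        have := Nat.lt_floor_add_one N
        exact_mod_cast (show (m : ℝ) < ⌊N⌋₊ + 1 + 1 by linarith)
      omega
    · simp only [← hn2, Int.toNat_natCast]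
  · intro s hs
    simp only [mem_filter, mem_Icc] at hs
    rw [Int.toNat_of_nonneg (hpos s hs.1.1).le]

theorem sum_rhoStar_eq_s17 {R x N : ℝ} (hx : 0 < x) (hN : 0 < N) {a : ℤ} (haN : |(a : ℝ)| < x / N) :
    ∑ q ∈ (Ioc ⌊x / N⌋₊ ⌊x⌋₊).filter (fun q : ℕ => Int.gcd (q : ℤ) a = 1), rhoStar R x q a =
      ∑ s ∈ Icc 1 (⌊N⌋₊ + 1),
        ∑ q ∈ (Ioc ⌊x / N⌋₊ ⌊min x ((x - a) / s)⌋₊).filter (fun q : ℕ => Int.gcd (q : ℤ) a = 1),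
          FR R (a + (q : ℤ) * (s : ℤ)) := by
  rw [sum_congr rfl fun q hq =>
    rhoStar_eq_sum hx hN haN (mem_Ioc.1 (mem_filter.1 hq).1).1]
  refine sum_comm' fun q s => ?_
  simp only [mem_filter, mem_Ioc, mem_Icc]
  constructor
  · rintro ⟨⟨⟨h1, h2⟩, h3⟩, h4, h5⟩
    have hs : (0 : ℝ) < s := by exact_mod_cast h4.1
    refine ⟨⟨⟨h1, Nat.le_floor (le_min ((Nat.le_floor_iff hx.le).1 h2) ?_)⟩, h3⟩, h4⟩
    rw [le_div_iff₀ hs]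
    linarith
  · rintro ⟨⟨⟨h1, h2⟩, h3⟩, h4⟩
    have hs : (0 : ℝ) < s := by exact_mod_cast h4.1
    have h5 := le_min_iff.1 ((Nat.le_floor_iff' (by omega)).1 h2)
    refine ⟨⟨⟨h1, Nat.le_floor h5.1⟩, h3⟩, h4, ?_⟩
    have := (le_div_iff₀ hs).1 h5.2
    linarith

theorem abs_floor_sub_floor_sub_max_le {A B : ℝ} (hA : 0 ≤ A) (hB : 0 ≤ B) :
    |((⌊B⌋₊ - ⌊A⌋₊ : ℕ) : ℝ) - max 0 (B - A)| ≤ 1 := by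
  have hA1 := Nat.floor_le hA
  have hA2 := Nat.lt_floor_add_one A
  have hB1 := Nat.floor_le hB
  have hB2 := Nat.lt_floor_add_one B
  rcases le_total A B with h | h
  · rw [max_eq_right (sub_nonneg.2 h), Nat.cast_sub (Nat.floor_le_floor h), abs_le]
    constructor <;> linarith
  · rw [max_eq_left (sub_nonpos.2 h), Nat.sub_eq_zero_of_le (Nat.floor_le_floor h)]
    simp

theorem abs_max_min_sub_max_le {x N : ℝ} (hx : 0 < x) (a : ℝ) {s : ℕ} (hs : 1 ≤ s) :
    |max 0 (min x ((x - a) / s) - x / N) - max 0 (x / s - x / N)| ≤ |a| / s := by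
  have hs' : (1 : ℝ) ≤ s := by exact_mod_cast hs
  have hxs : x / s ≤ x := div_le_self hx.le hs'
  calc _ ≤ |(min x ((x - a) / s) - x / N) - (x / s - x / N)| := by
        simpa using abs_max_sub_max_le_max 0 (min x ((x - a) / s) - x / N) 0 (x / s - x / N)
    _ = |min x ((x - a) / s) - min x (x / s)| := by
        rw [sub_sub_sub_cancel_right, min_eq_right hxs]
    _ ≤ |(x - a) / s - x / s| := by
        simpa using abs_min_sub_min_le_max x ((x - a) / s) x (x / s)
    _ = |a| / s := by
        rw [← sub_div, sub_sub_cancel_left, abs_div, abs_neg, Nat.abs_cast]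

theorem abs_mul_meanFR_sub_le {x N R : ℝ} (hx : 0 < x) (hN : 1 ≤ N) {a : ℤ} (ha : a ≠ 0)
    (haR : |(a : ℝ)| * N ≤ R) {s : ℕ} (hs : s ∈ Icc 1 ⌊N⌋₊) :
    |max 0 (min x ((x - a) / s) - x / N) * meanFR R a s -
        (if Int.gcd (s : ℤ) a = 1 then x * (1 / (s.totient : ℝ) * (1 - s / N)) else 0)|
      ≤ |(a : ℝ)| * (1 / s.totient) := by
  have hs1 := (mem_Icc.1 hs).1
  have hs0 : (0 : ℝ) < s := by exact_mod_cast hs1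
  have hsN : (s : ℝ) ≤ N := (Nat.le_floor_iff (by linarith)).1 (mem_Icc.1 hs).2
  have hφ : (0 : ℝ) < s.totient := by exact_mod_cast Nat.totient_pos.2 hs1
  have hR : a.natAbs * s ≤ ⌊R⌋₊ := by
    refine Nat.le_floor (le_trans ?_ haR)
    rw [Nat.cast_mul, Nat.cast_natAbs, Int.cast_abs]
    gcongr
  split_ifs with hsa
  · have hdiff := abs_max_min_sub_max_le (N := N) hx (a : ℝ) hs1
    have hnn : 0 ≤ x / s - x / N := sub_nonneg.2 (by gcongr)
    have hmain : x * (1 / (s.totient : ℝ) * (1 - s / N)) =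
        max 0 (x / s - x / N) * (s / s.totient) := by
      have : N ≠ 0 := by linarith
      rw [max_eq_right hnn]
      field_simp
    rw [meanFR_of_coprime ha (by omega) hR hsa, hmain, ← sub_mul, abs_mul,
      abs_of_pos (div_pos hs0 hφ)]
    calc _ ≤ |(a : ℝ)| / s * (s / s.totient) := by gcongr
      _ = _ := by field_simp
  · rw [meanFR_of_not_coprime ha (by omega) hR hsa]
    simp only [mul_zero, sub_zero, abs_zero]
    positivity

theorem abs_mul_meanFR_floor_add_one_le {x N R : ℝ} (hx : 0 < x) (hN : 1 ≤ N) {a : ℤ}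
    (ha : a ≠ 0) :
    |max 0 (min x ((x - a) / (⌊N⌋₊ + 1 : ℕ)) - x / N) * meanFR R a (⌊N⌋₊ + 1)|
      ≤ 2 ^ #a.natAbs.primeFactors * |(a : ℝ)| := by
  set s := ⌊N⌋₊ + 1 with hs
  have hs0 : (0 : ℝ) < s := by exact_mod_cast Nat.succ_pos _
  have hsN : N ≤ s := by rw [hs]; push_cast; exact (Nat.lt_floor_add_one N).le
  have hφ : (1 : ℝ) ≤ s.totient := by exact_mod_cast Nat.totient_pos.2 (Nat.succ_pos _)
  have hdiff := abs_max_min_sub_max_le (N := N) hx (a : ℝ) (s := s) (by omega)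
  rw [max_eq_left (b := x / s - x / N) (sub_nonpos.2 (by gcongr)), sub_zero] at hdiff
  rw [abs_mul]
  calc _ ≤ |(a : ℝ)| / s * (2 ^ #a.natAbs.primeFactors * (s / s.totient)) := by
        gcongr
        exact abs_meanFR_le R ha (by omega)
    _ = 2 ^ #a.natAbs.primeFactors * |(a : ℝ)| / s.totient := by field_simp
    _ ≤ _ := div_le_self (by positivity) hφ

/-- average of `ρ_R*` over large moduli coprime to `a`. -/
theorem rho_large_moduli_coprime :
    ∃ C : ℝ, 0 < C ∧ ∀ x N R : ℝ, 2 ≤ x → 1 ≤ N → N ≤ x → 1 ≤ R → R ≤ x →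
      ∀ a : ℤ, a ≠ 0 → |(a : ℝ)| < x / N → |(a : ℝ)| * N ≤ R →
      |(∑ q ∈ (Finset.Ioc ⌊x / N⌋₊ ⌊x⌋₊).filter (fun q : ℕ => Int.gcd (q : ℤ) a = 1),
            rhoStar R x q a)
          - x * ∑ s ∈ (Finset.Icc 1 ⌊N⌋₊).filter (fun s : ℕ => Int.gcd (s : ℤ) a = 1),
              (1 / (Nat.totient s : ℝ)) * (1 - (s : ℝ) / N)|
        ≤ C * ((2 : ℝ) ^ a.natAbs.primeFactors.card * R * N
            + |(a : ℝ)| * Real.log (2 * N)) := by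
  refine ⟨4 * exp 2 + 1, by positivity, fun x N R hx hN hNx hR _ a ha haN haR => ?_⟩
  have hx0 : 0 < x := by linarith
  have hN0 : 0 < N := by linarith
  set Ω : ℝ := 2 ^ #a.natAbs.primeFactors
  have hΩ0 : 0 < Ω := by positivity
  set S : ℕ → ℝ := fun s =>
    ∑ q ∈ (Ioc ⌊x / N⌋₊ ⌊min x ((x - a) / s)⌋₊).filter (fun q : ℕ => Int.gcd (q : ℤ) a = 1),
      FR R (a + (q : ℤ) * (s : ℤ))
  set E : ℕ → ℝ := fun s => max 0 (min x ((x - a) / s) - x / N) * meanFR R a s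
  set M : ℕ → ℝ := fun s =>
    if Int.gcd (s : ℤ) a = 1 then x * (1 / (s.totient : ℝ) * (1 - s / N)) else 0
  have hax : (a : ℝ) ≤ x := (le_abs_self _).trans (haN.le.trans (div_le_self hx0.le hN))
  have hSE : |∑ s ∈ Icc 1 (⌊N⌋₊ + 1), S s - ∑ s ∈ Icc 1 (⌊N⌋₊ + 1), E s| ≤
      4 * exp 2 * (Ω * R * N) := by
    rw [← sum_sub_distrib]
    calc _ ≤ ∑ s ∈ Icc 1 (⌊N⌋₊ + 1), 2 * exp 2 * Ω * R := by
          refine (abs_sum_le_sum_abs _ _).trans (sum_le_sum fun s _ => ?_)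
          refine abs_sum_FR_sub_le (by linarith) ha s _ _
            (abs_floor_sub_floor_sub_max_le (by positivity) (le_min hx0.le ?_))
          exact div_nonneg (sub_nonneg.2 hax) (Nat.cast_nonneg _)
      _ = (⌊N⌋₊ + 1) * (2 * exp 2 * Ω * R) := by
          rw [sum_const, Nat.card_Icc, nsmul_eq_mul]
          push_cast
          ring
      _ ≤ (2 * N) * (2 * exp 2 * Ω * R) := by
          gcongr
          linarith [Nat.floor_le hN0.le]
      _ = _ := by ring
  have hEM : |∑ s ∈ Icc 1 ⌊N⌋₊, E s - ∑ s ∈ Icc 1 ⌊N⌋₊, M s| ≤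
      2 * exp 2 * (|(a : ℝ)| * log (2 * N)) := by
    have hlog : 1 + log N ≤ 2 * log (2 * N) := by
      rw [log_mul two_ne_zero hN0.ne']
      linarith [log_two_gt_d9, log_nonneg hN]
    rw [← sum_sub_distrib]
    calc _ ≤ ∑ s ∈ Icc 1 ⌊N⌋₊, |(a : ℝ)| * (1 / s.totient) :=
          (abs_sum_le_sum_abs _ _).trans
            (sum_le_sum fun s hs => abs_mul_meanFR_sub_le hx0 hN ha haR hs)
      _ ≤ |(a : ℝ)| * (exp 2 * (2 * log (2 * N))) := by
          rw [← mul_sum]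
          gcongr
          exact (sum_one_div_totient_le hN).trans (by gcongr)
      _ = _ := by ring
  have hlast : |E (⌊N⌋₊ + 1)| ≤ Ω * R * N := by
    refine (abs_mul_meanFR_floor_add_one_le hx0 hN ha).trans ?_
    rw [mul_assoc]
    gcongr
    calc |(a : ℝ)| ≤ |(a : ℝ)| * N := le_mul_of_one_le_right (abs_nonneg _) hN
      _ ≤ R := haR
      _ ≤ R * N := le_mul_of_one_le_right (by linarith) hN
  have hMsum : x * ∑ s ∈ (Icc 1 ⌊N⌋₊).filter (fun s : ℕ => Int.gcd (s : ℤ) a = 1),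
      (1 / (Nat.totient s : ℝ)) * (1 - (s : ℝ) / N) = ∑ s ∈ Icc 1 ⌊N⌋₊, M s := by
    rw [mul_sum, sum_filter]
  have hEsum : ∑ s ∈ Icc 1 (⌊N⌋₊ + 1), E s = ∑ s ∈ Icc 1 ⌊N⌋₊, E s + E (⌊N⌋₊ + 1) :=
    sum_Icc_succ_top (by omega) _
  have hlogN : 0 ≤ |(a : ℝ)| * log (2 * N) :=
    mul_nonneg (abs_nonneg _) (log_nonneg (by linarith))
  have hexp := exp_pos 2
  have hprod := mul_nonneg hexp.le hlogN
  rw [sum_rhoStar_eq_s17 hx0 hN0 haN, hMsum, abs_le]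
  rw [hEsum, abs_le] at hSE
  rw [abs_le] at hEM hlast
  constructor <;> linarith
end
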